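/- arXiv:1206.5440 — 4 statements merged into one kernel-verified Lean document; each statement's English description precedes it below -/
import Mathlib

section
/- Let n ≥ 2 and let Φ : ℝⁿ → ℂ be a Schwartz function. There is a constant C > 0, depending only on Φ and n, such that for all s ≥ 1, all orthonormal unit vectors e₁, e₂ ∈ ℝⁿ, and every Schwartz function u : ℝⁿ → ℂ: ∫_{ℝⁿ} |p_ζ(ξ)|^{−1} |𝓕(Φu)(ξ)|² dξ ≤ C ∫_{ℝⁿ} (s + |p_ζ(ξ)|)^{−1} |𝓕u(ξ)|² dξ, where both sides are interpreted as Lebesgue integrals with values in [0,∞]. (Equivalently, ‖Φu‖_{Ẋ^{−1/2}_ζ} ≲ ‖u‖_{X^{−1/2}_ζ}.) -/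
open MeasureTheory
open scoped RealInnerProductSpace FourierTransform

/-- The modulus `|p_ζ(ξ)|` of the symbol `p_ζ(ξ) = -‖ξ‖² + 2iζ·ξ` of the conjugated
Laplacian `Δ + 2ζ·∇`, where `ζ = s(e₁ - i e₂)`. -/
noncomputable def pAbs {n : ℕ} (s : ℝ) (e₁ e₂ ξ : EuclideanSpace ℝ (Fin n)) : ℝ :=
  Real.sqrt ((‖ξ‖ ^ 2 - 2 * s * ⟪e₂, ξ⟫) ^ 2 + 4 * s ^ 2 * ⟪e₁, ξ⟫ ^ 2)

open scoped ENNReal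

/-- The function `x ↦ |x| ^ (-1/2)`, equal to `∞` at the origin. -/
noncomputable def invSqrtAbs (x : ℝ) : ℝ≥0∞ := (ENNReal.ofReal √|x|)⁻¹

lemma measurable_invSqrtAbs : Measurable invSqrtAbs := by
  unfold invSqrtAbs; fun_prop

lemma setLIntegral_invSqrtAbs_lt_top :
    ∫⁻ x in Set.Ioc (0 : ℝ) 1, invSqrtAbs x < ∞ := by
  have h := intervalIntegral.intervalIntegrable_rpow' (a := 0) (b := 1) (r := -(1 / 2))
    (by norm_num)
  rw [intervalIntegrable_iff_integrableOn_Ioc_of_le zero_le_one] at h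
  refine lt_of_le_of_lt (setLIntegral_mono' measurableSet_Ioc fun x hx => ?_) h.2
  have hx0 : 0 < x := hx.1
  rw [invSqrtAbs, abs_of_pos hx0, ← ENNReal.ofReal_inv_of_pos (Real.sqrt_pos.2 hx0),
    Real.sqrt_eq_rpow, ← Real.rpow_neg hx0.le]
  exact Real.ofReal_le_enorm _

/-- The integral of `|x| ^ (-1/2)` over intervals of unit length is uniformly bounded. -/
lemma exists_lintegral_invSqrtAbs_le :
    ∃ H : ℝ≥0∞, H < ∞ ∧ ∀ β : ℝ, ∫⁻ r in Set.Icc (0 : ℝ) 1, invSqrtAbs (β + r) ≤ H := by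
  set I := ∫⁻ x in Set.Ioc (0 : ℝ) 1, invSqrtAbs x with hI
  set g : ℝ → ℝ≥0∞ := (Set.Ioc (0 : ℝ) 1).indicator invSqrtAbs with hg
  have hgm : Measurable g := measurable_invSqrtAbs.indicator measurableSet_Ioc
  have hgI : ∫⁻ x, g x = I := lintegral_indicator measurableSet_Ioc _
  have hone : ∀ x : ℝ, 1 ≤ |x| → invSqrtAbs x ≤ 1 := fun x hx => by
    rw [invSqrtAbs, ENNReal.inv_le_one]
    simpa using Real.one_le_sqrt.2 hx
  have hle : ∀ x : ℝ, x ≠ 0 → invSqrtAbs x ≤ 1 + (g x + g (-x)) := fun x hx => by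
    by_cases h1 : 1 ≤ |x|
    · exact (hone x h1).trans le_self_add
    push Not at h1
    rcases lt_or_gt_of_ne hx with h | h
    · have : g (-x) = invSqrtAbs x := by
        have hmem : -x ∈ Set.Ioc (0 : ℝ) 1 := ⟨by linarith, by linarith [neg_abs_le x]⟩
        rw [hg, Set.indicator_of_mem hmem]
        simp [invSqrtAbs]
      rw [this]
      exact le_add_left le_add_self
    · have : g x = invSqrtAbs x := by
        have hmem : x ∈ Set.Ioc (0 : ℝ) 1 := ⟨h, by linarith [le_abs_self x]⟩
        rw [hg, Set.indicator_of_mem hmem]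
      rw [this]
      exact le_add_left le_self_add
  refine ⟨1 + (I + I), by simp [setLIntegral_invSqrtAbs_lt_top, hI], fun β => ?_⟩
  have hae : ∀ᵐ r ∂(volume.restrict (Set.Icc (0 : ℝ) 1)), β + r ≠ 0 := by
    refine ae_restrict_of_ae ?_
    filter_upwards [Measure.ae_ne volume (-β)] with r hr h
    exact hr (by linarith)
  calc ∫⁻ r in Set.Icc (0 : ℝ) 1, invSqrtAbs (β + r)
      ≤ ∫⁻ r in Set.Icc (0 : ℝ) 1, (1 + (g (β + r) + g (-(β + r)))) :=
        lintegral_mono_ae (hae.mono fun r hr => hle _ hr)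
    _ = (∫⁻ _ in Set.Icc (0 : ℝ) 1, 1) + ((∫⁻ r in Set.Icc (0 : ℝ) 1, g (β + r))
          + ∫⁻ r in Set.Icc (0 : ℝ) 1, g (-(β + r))) := by
        rw [lintegral_add_left (by fun_prop), lintegral_add_left (by fun_prop)]
    _ ≤ 1 + ((∫⁻ r, g (β + r)) + ∫⁻ r, g (-(β + r))) := by
        gcongr
        · simp
        · exact Measure.restrict_le_self
        · exact Measure.restrict_le_self
    _ = 1 + (I + I) := by
        rw [lintegral_add_left_eq_self (fun r => g r), lintegral_add_left_eq_self (fun r => g (-r)),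
          lintegral_neg_eq_self, hgI]

section Averaging

variable {E : Type*} [NormedAddCommGroup E] [InnerProductSpace ℝ E] [FiniteDimensional ℝ E]
  [MeasurableSpace E] [BorelSpace E]

/-- The integral of a function equals the integral of its averages over unit segments. -/
lemma lintegral_eq_lintegral_segment (v : E) {f : E → ℝ≥0∞} (hf : Measurable f) :
    ∫⁻ x, f x = ∫⁻ x, ∫⁻ r in Set.Icc (0 : ℝ) 1, f (x + r • v) := by
  rw [lintegral_lintegral_swap (by fun_prop)]
  simp [lintegral_add_right_eq_self f]

omit [InnerProductSpace ℝ E] [FiniteDimensional ℝ E] [MeasurableSpace E] [BorelSpace E] in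
lemma one_add_norm_pow_neg_le (N : ℕ) (x y : E) (hy : ‖y‖ ≤ 1) :
    ((1 + ‖x + y‖) ^ N)⁻¹ ≤ 2 ^ N * ((1 + ‖x‖) ^ N)⁻¹ := by
  rw [← inv_inv (2 ^ N : ℝ), ← mul_inv]
  gcongr
  rw [← inv_pow, ← mul_pow]
  gcongr
  have := norm_sub_le (x + y) y
  simp only [add_sub_cancel_right] at this
  linarith [norm_nonneg (x + y)]

/-- A factor `|⟪v, x⟫ - α x| ^ (-1/2)` with `α` constant in the direction of the unit vector `v` can
be integrated out against polynomially decaying weights. -/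
lemma lintegral_mul_invSqrtAbs_le {H : ℝ≥0∞}
    (hH : ∀ β : ℝ, ∫⁻ r in Set.Icc (0 : ℝ) 1, invSqrtAbs (β + r) ≤ H) (N : ℕ) (z v : E)
    (hv : ‖v‖ = 1) {g : E → ℝ≥0∞} (hg : Measurable g) (hgv : ∀ x, ∀ r : ℝ, g (x + r • v) = g x)
    {α : E → ℝ} (hα : Measurable α) (hαv : ∀ x, ∀ r : ℝ, α (x + r • v) = α x) :
    ∫⁻ x, ENNReal.ofReal ((1 + ‖x - z‖) ^ N)⁻¹ * (g x * invSqrtAbs (⟪v, x⟫ - α x)) ≤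
      2 ^ N * H * ∫⁻ x, ENNReal.ofReal ((1 + ‖x - z‖) ^ N)⁻¹ * g x := by
  have hm := measurable_invSqrtAbs
  rw [lintegral_eq_lintegral_segment v (by fun_prop), ← lintegral_const_mul _ (by fun_prop)]
  refine lintegral_mono fun x => ?_
  calc _ ≤ ∫⁻ r in Set.Icc (0 : ℝ) 1, (2 ^ N * (ENNReal.ofReal ((1 + ‖x - z‖) ^ N)⁻¹ * g x)) *
        invSqrtAbs ((⟪v, x⟫ - α x) + r) := by
        refine setLIntegral_mono' measurableSet_Icc fun r hr => ?_
        have h1 : ENNReal.ofReal ((1 + ‖x + r • v - z‖) ^ N)⁻¹ ≤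
            2 ^ N * ENNReal.ofReal ((1 + ‖x - z‖) ^ N)⁻¹ := by
          have := one_add_norm_pow_neg_le N (x - z) (r • v)
            (by rw [norm_smul, hv, Real.norm_of_nonneg hr.1]; simpa using hr.2)
          rw [sub_add_eq_add_sub] at this
          refine (ENNReal.ofReal_le_ofReal this).trans_eq ?_
          rw [ENNReal.ofReal_mul (by positivity), ENNReal.ofReal_pow (by norm_num)]
          simp
        have h2 : ⟪v, x + r • v⟫ - α (x + r • v) = (⟪v, x⟫ - α x) + r := by
          rw [hαv, inner_add_right, inner_smul_right, real_inner_self_eq_norm_sq, hv]; ring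
        rw [hgv, h2, ← mul_assoc, ← mul_assoc]
        gcongr
    _ = (2 ^ N * (ENNReal.ofReal ((1 + ‖x - z‖) ^ N)⁻¹ * g x)) *
        ∫⁻ r in Set.Icc (0 : ℝ) 1, invSqrtAbs ((⟪v, x⟫ - α x) + r) :=
        lintegral_const_mul _ (by fun_prop)
    _ ≤ (2 ^ N * (ENNReal.ofReal ((1 + ‖x - z‖) ^ N)⁻¹ * g x)) * H := by
        gcongr; exact hH _
    _ = _ := by ring

/-- The weight `|⟪w, x⟫| ^ (-1/2) |⟪v, x⟫ - α x| ^ (-1/2)`, with `v ⊥ w` unit vectors and `α`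
constant in the direction `v`, integrates to a bounded quantity against decaying weights. -/
lemma lintegral_invSqrtAbs_mul_invSqrtAbs_le {H : ℝ≥0∞}
    (hH : ∀ β : ℝ, ∫⁻ r in Set.Icc (0 : ℝ) 1, invSqrtAbs (β + r) ≤ H) (N : ℕ) (z v w : E)
    (hv : ‖v‖ = 1) (hw : ‖w‖ = 1) (hwv : ⟪w, v⟫ = 0)
    {α : E → ℝ} (hα : Measurable α) (hαv : ∀ x, ∀ r : ℝ, α (x + r • v) = α x) :
    ∫⁻ x, ENNReal.ofReal ((1 + ‖x - z‖) ^ N)⁻¹ *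
        (invSqrtAbs ⟪w, x⟫ * invSqrtAbs (⟪v, x⟫ - α x)) ≤
      (2 ^ N * H) ^ 2 * ∫⁻ x : E, ENNReal.ofReal ((1 + ‖x‖) ^ N)⁻¹ := by
  have hm := measurable_invSqrtAbs
  refine (lintegral_mul_invSqrtAbs_le hH N z v hv (g := fun x => invSqrtAbs ⟪w, x⟫) (by fun_prop)
    (fun x r => by simp [inner_add_right, inner_smul_right, hwv]) hα hαv).trans ?_
  rw [pow_two, mul_assoc (2 ^ N * H)]
  gcongr
  have := lintegral_mul_invSqrtAbs_le hH N z w hw (g := fun _ => 1) (by fun_prop)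
    (fun _ _ => rfl) (α := fun _ => 0) (by fun_prop) (fun _ _ => rfl)
  simp only [one_mul, mul_one, sub_zero] at this
  rwa [lintegral_sub_right_eq_self (fun x : E => ENNReal.ofReal ((1 + ‖x‖) ^ N)⁻¹) z] at this

end Averaging

section Symbol

variable {n : ℕ} {s : ℝ} {e₁ e₂ : EuclideanSpace ℝ (Fin n)}

lemma pAbs_nonneg (s : ℝ) (e₁ e₂ ξ : EuclideanSpace ℝ (Fin n)) : 0 ≤ pAbs s e₁ e₂ ξ :=
  Real.sqrt_nonneg _

@[fun_prop]
lemma continuous_pAbs (s : ℝ) (e₁ e₂ : EuclideanSpace ℝ (Fin n)) :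
    Continuous (pAbs s e₁ e₂) := by
  unfold pAbs; fun_prop

@[fun_prop]
lemma measurable_pAbs (s : ℝ) (e₁ e₂ : EuclideanSpace ℝ (Fin n)) :
    Measurable (pAbs s e₁ e₂) :=
  (continuous_pAbs s e₁ e₂).measurable

lemma sq_pAbs (s : ℝ) (e₁ e₂ ξ : EuclideanSpace ℝ (Fin n)) :
    pAbs s e₁ e₂ ξ ^ 2 =
      (‖ξ‖ ^ 2 - 2 * s * ⟪e₂, ξ⟫) ^ 2 + (2 * s * ⟪e₁, ξ⟫) ^ 2 := by
  rw [pAbs, Real.sq_sqrt (by positivity)]; ring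

lemma abs_re_le_pAbs (s : ℝ) (e₁ e₂ ξ : EuclideanSpace ℝ (Fin n)) :
    |‖ξ‖ ^ 2 - 2 * s * ⟪e₂, ξ⟫| ≤ pAbs s e₁ e₂ ξ :=
  Real.abs_le_sqrt (by nlinarith [sq_nonneg (s * ⟪e₁, ξ⟫)])

lemma abs_im_le_pAbs (s : ℝ) (e₁ e₂ ξ : EuclideanSpace ℝ (Fin n)) :
    |2 * s * ⟪e₁, ξ⟫| ≤ pAbs s e₁ e₂ ξ :=
  Real.abs_le_sqrt (by nlinarith [sq_nonneg (‖ξ‖ ^ 2 - 2 * s * ⟪e₂, ξ⟫)])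

lemma pAbs_le_add (s : ℝ) (e₁ e₂ ξ η : EuclideanSpace ℝ (Fin n)) :
    pAbs s e₁ e₂ η ≤ pAbs s e₁ e₂ ξ +
      |(‖η‖ ^ 2 - 2 * s * ⟪e₂, η⟫) - (‖ξ‖ ^ 2 - 2 * s * ⟪e₂, ξ⟫)| +
      |2 * s * ⟪e₁, η⟫ - 2 * s * ⟪e₁, ξ⟫| := by
  have key : ∀ a b a' b' : ℝ, √(a' ^ 2 + b' ^ 2) ≤ √(a ^ 2 + b ^ 2) + |a' - a| + |b' - b| := by
    intro a b a' b'
    have h := norm_add_le (⟨a, b⟩ : ℂ) ⟨a' - a, b' - b⟩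
    have h2 := Complex.norm_le_abs_re_add_abs_im ⟨a' - a, b' - b⟩
    have h3 : (⟨a, b⟩ : ℂ) + ⟨a' - a, b' - b⟩ = ⟨a', b'⟩ := by
      apply Complex.ext <;> simp
    rw [h3, Complex.norm_eq_sqrt_sq_add_sq, Complex.norm_eq_sqrt_sq_add_sq] at h
    simp only at h h2
    linarith
  have := key (‖ξ‖ ^ 2 - 2 * s * ⟪e₂, ξ⟫) (2 * s * ⟪e₁, ξ⟫)
    (‖η‖ ^ 2 - 2 * s * ⟪e₂, η⟫) (2 * s * ⟪e₁, η⟫)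
  have e : ∀ x : EuclideanSpace ℝ (Fin n), pAbs s e₁ e₂ x =
      √((‖x‖ ^ 2 - 2 * s * ⟪e₂, x⟫) ^ 2 + (2 * s * ⟪e₁, x⟫) ^ 2) := fun x => by
    rw [← sq_pAbs, Real.sqrt_sq (pAbs_nonneg ..)]
  rwa [← e, ← e] at this

/-- The weight `s + |p_ζ|` is slowly varying. -/
lemma add_pAbs_le (hs : 1 ≤ s) (h₁ : ‖e₁‖ = 1) (h₂ : ‖e₂‖ = 1)
    (ξ η : EuclideanSpace ℝ (Fin n)) :
    s + pAbs s e₁ e₂ η ≤ 12 * (1 + ‖ξ - η‖) ^ 2 * (s + pAbs s e₁ e₂ ξ) := by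
  have hp := pAbs_le_add s e₁ e₂ ξ η
  have hp0 := pAbs_nonneg s e₁ e₂ ξ
  have i₁ : |⟪e₁, η - ξ⟫| ≤ ‖ξ - η‖ := by
    have := abs_real_inner_le_norm e₁ (η - ξ)
    rwa [h₁, one_mul, norm_sub_rev] at this
  have i₂ : |⟪e₂, η - ξ⟫| ≤ ‖ξ - η‖ := by
    have := abs_real_inner_le_norm e₂ (η - ξ)
    rwa [h₂, one_mul, norm_sub_rev] at this
  have i₃ : |⟪e₂, ξ⟫| ≤ ‖ξ‖ := by
    have := abs_real_inner_le_norm e₂ ξ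
    rwa [h₂, one_mul] at this
  have hd := norm_nonneg (ξ - η)
  have hx := norm_nonneg ξ
  have hη : ‖η‖ ≤ ‖ξ‖ + ‖ξ - η‖ := by
    have := norm_sub_le ξ (ξ - η)
    simpa using this
  have hξ : ‖ξ‖ ≤ ‖η‖ + ‖ξ - η‖ := by
    have := norm_add_le η (ξ - η)
    simpa using this
  have hξp : ‖ξ‖ ≤ 4 * s + pAbs s e₁ e₂ ξ / 2 := by
    by_contra! h
    have h1 := (le_abs_self _).trans (abs_re_le_pAbs s e₁ e₂ ξ)
    have h2 := (le_abs_self _).trans i₃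
    nlinarith
  set d := ‖ξ - η‖
  set p := pAbs s e₁ e₂ ξ
  have hsq : |‖η‖ ^ 2 - ‖ξ‖ ^ 2| ≤ d * (2 * ‖ξ‖ + d) := by
    have : ‖η‖ ^ 2 - ‖ξ‖ ^ 2 = (‖η‖ - ‖ξ‖) * (‖η‖ + ‖ξ‖) := by ring
    rw [this, abs_mul, abs_of_nonneg (by positivity : 0 ≤ ‖η‖ + ‖ξ‖)]
    have : |‖η‖ - ‖ξ‖| ≤ d := abs_le.2 ⟨by linarith, by linarith⟩
    exact mul_le_mul this (by linarith) (by positivity) hd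
  have hre : |(‖η‖ ^ 2 - 2 * s * ⟪e₂, η⟫) - (‖ξ‖ ^ 2 - 2 * s * ⟪e₂, ξ⟫)| ≤
      d * (2 * ‖ξ‖ + d) + 2 * s * d := by
    have : (‖η‖ ^ 2 - 2 * s * ⟪e₂, η⟫) - (‖ξ‖ ^ 2 - 2 * s * ⟪e₂, ξ⟫) =
        (‖η‖ ^ 2 - ‖ξ‖ ^ 2) - 2 * s * ⟪e₂, η - ξ⟫ := by rw [inner_sub_right]; ring
    rw [this]
    refine (abs_sub _ _).trans (add_le_add hsq ?_)
    rw [abs_mul, abs_of_nonneg (by positivity : 0 ≤ 2 * s)]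
    gcongr
  have him : |2 * s * ⟪e₁, η⟫ - 2 * s * ⟪e₁, ξ⟫| ≤ 2 * s * d := by
    rw [← mul_sub, ← inner_sub_right, abs_mul, abs_of_nonneg (by positivity : 0 ≤ 2 * s)]
    gcongr
  nlinarith [mul_nonneg hd hp0, mul_nonneg (mul_nonneg hd hd) hp0, mul_nonneg hd (sub_nonneg.2 hs),
    mul_nonneg (mul_nonneg hd hd) (sub_nonneg.2 hs), mul_le_mul_of_nonneg_left hξp hd]

/-- The radius of the one-dimensional slice of the sphere of radius `s` and centre `c` by the line
through `ξ` in the direction of the unit vector `v`. -/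
noncomputable def sliceRadius (s : ℝ) (c v ξ : EuclideanSpace ℝ (Fin n)) : ℝ :=
  √(s ^ 2 - (‖ξ - c‖ ^ 2 - ⟪v, ξ - c⟫ ^ 2))

@[fun_prop]
lemma continuous_sliceRadius (s : ℝ) (c v : EuclideanSpace ℝ (Fin n)) :
    Continuous (sliceRadius s c v) := by
  unfold sliceRadius; fun_prop

lemma sliceRadius_add_smul (s : ℝ) (c : EuclideanSpace ℝ (Fin n)) {v : EuclideanSpace ℝ (Fin n)}
    (hv : ‖v‖ = 1) (ξ : EuclideanSpace ℝ (Fin n)) (r : ℝ) :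
    sliceRadius s c v (ξ + r • v) = sliceRadius s c v ξ := by
  have h : ξ + r • v - c = (ξ - c) + r • v := by abel
  rw [sliceRadius, sliceRadius, h, norm_add_sq_real, inner_add_right, inner_smul_right,
    inner_smul_right, real_inner_self_eq_norm_sq, norm_smul, hv, Real.norm_eq_abs,
    real_inner_comm v (ξ - c), mul_one, sq_abs]
  congr 1
  ring

lemma exists_abs_mul_abs_sub_le (x A : ℝ) :
    |x| * |x - √A| ≤ |x ^ 2 - A| ∨ |x| * |x - -√A| ≤ |x ^ 2 - A| := by
  rcases le_total 0 A with hA | hA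
  · have h : x ^ 2 - A = (x + √A) * (x - √A) := by nlinarith [Real.sq_sqrt hA]
    have h0 := Real.sqrt_nonneg A
    rw [h, abs_mul, sub_neg_eq_add, mul_comm |x + √A|]
    rcases le_total 0 x with hx | hx
    · left
      rw [mul_comm]
      refine mul_le_mul_of_nonneg_left ?_ (abs_nonneg _)
      rw [abs_of_nonneg hx, abs_of_nonneg (by linarith)]; linarith
    · right
      refine mul_le_mul_of_nonneg_right ?_ (abs_nonneg _)
      rw [abs_of_nonpos hx, abs_of_nonpos (by linarith)]; linarith
  · left
    rw [Real.sqrt_eq_zero_of_nonpos hA, sub_zero, ← abs_mul, ← pow_two,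
      abs_of_nonneg (by positivity), abs_of_nonneg (by nlinarith)]
    linarith

lemma ofReal_mul_inv_le_mul_invSqrtAbs {s p a x y : ℝ} (hs : 0 < s) (ha : 0 < a)
    (hp : 0 ≤ p) (h : s ^ 2 * (|x| * |y|) ≤ (a * p) ^ 2) :
    ENNReal.ofReal s * (ENNReal.ofReal p)⁻¹ ≤
      ENNReal.ofReal a * (invSqrtAbs x * invSqrtAbs y) := by
  rw [invSqrtAbs, invSqrtAbs, ← ENNReal.mul_inv (by simp) (by simp),
    ← ENNReal.ofReal_mul (by positivity), ← Real.sqrt_mul (abs_nonneg x)]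
  generalize hXdef : √(|x| * |y|) = X
  have h0 : 0 ≤ X := hXdef ▸ Real.sqrt_nonneg _
  have hX : s * X ≤ a * p := by
    refine abs_le_of_sq_le_sq' ?_ (by positivity) |>.2
    rwa [← hXdef, mul_pow, Real.sq_sqrt (by positivity)]
  rcases h0.eq_or_lt with h0 | h0
  · rw [← h0]
    simp [ENNReal.mul_top, ha]
  · have hp' : 0 < p := by
      by_contra! hc
      nlinarith [mul_pos hs h0]
    rw [← ENNReal.ofReal_inv_of_pos h0, ← ENNReal.ofReal_inv_of_pos hp',
      ← ENNReal.ofReal_mul hs.le, ← ENNReal.ofReal_mul ha.le]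
    refine ENNReal.ofReal_le_ofReal ?_
    rw [← div_eq_mul_inv, ← div_eq_mul_inv, div_le_div_iff₀ hp' h0]
    exact hX

/-- Where `|p_ζ| < s / 2`, the coordinate of `ξ - s e₂` along some vector of an orthonormal basis
containing `e₁` is comparable to `s`. -/
lemma exists_le_mul_abs_inner (hs : 1 ≤ s) (h₂ : ‖e₂‖ = 1) (h₁₂ : ⟪e₁, e₂⟫ = 0)
    (b : OrthonormalBasis (Fin n) ℝ (EuclideanSpace ℝ (Fin n))) {i : Fin n} (hb : b i = e₁)
    {ξ : EuclideanSpace ℝ (Fin n)} (hξ : pAbs s e₁ e₂ ξ < s / 2) :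
    ∃ j ≠ i, s ≤ 2 * n * |⟪b j, ξ - s • e₂⟫| := by
  have hn : (1 : ℝ) ≤ n := by exact_mod_cast i.pos
  have hre := (neg_abs_le _).trans' (neg_le_neg (abs_re_le_pAbs s e₁ e₂ ξ))
  have him := abs_im_le_pAbs s e₁ e₂ ξ
  have hy : ‖ξ - s • e₂‖ ^ 2 = ‖ξ‖ ^ 2 - 2 * s * ⟪e₂, ξ⟫ + s ^ 2 := by
    rw [norm_sub_sq_real, inner_smul_right, norm_smul, h₂, real_inner_comm e₂ ξ, Real.norm_eq_abs,
      mul_one, sq_abs]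
    ring
  have hi : ⟪b i, ξ - s • e₂⟫ = ⟪e₁, ξ⟫ := by
    rw [hb, inner_sub_right, inner_smul_right, h₁₂]; ring
  have hi2 : ⟪e₁, ξ⟫ ^ 2 ≤ 1 / 16 := by
    rw [abs_mul, abs_of_nonneg (by positivity : 0 ≤ 2 * s)] at him
    have : |⟪e₁, ξ⟫| ≤ 1 / 4 := by nlinarith
    rw [← sq_abs]
    nlinarith [abs_nonneg ⟪e₁, ξ⟫]
  have hsum := b.sum_sq_inner_right (ξ - s • e₂)
  rw [← Finset.add_sum_erase _ _ (Finset.mem_univ i), hi] at hsum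
  by_contra! h
  have hlt : ∀ j ∈ Finset.univ.erase i, ⟪b j, ξ - s • e₂⟫ ^ 2 ≤ s ^ 2 / (4 * n) := fun j hj => by
    have hj' := h j (Finset.ne_of_mem_erase hj)
    rw [← sq_abs, le_div_iff₀ (by positivity)]
    nlinarith [abs_nonneg ⟪b j, ξ - s • e₂⟫, sq_nonneg ⟪b j, ξ - s • e₂⟫,
      mul_self_le_mul_self (by positivity) hj'.le,
      mul_nonneg (sub_nonneg.2 hn) (sq_nonneg |⟪b j, ξ - s • e₂⟫|)]
  have hle := Finset.sum_le_card_nsmul _ _ _ hlt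
  have hcard : ((Finset.univ.erase i).card : ℝ) ≤ n := by
    exact_mod_cast (Finset.card_erase_le).trans (by simp)
  rw [nsmul_eq_mul] at hle
  have : ((Finset.univ.erase i).card : ℝ) * (s ^ 2 / (4 * n)) ≤ n * (s ^ 2 / (4 * n)) := by gcongr
  have e : (n : ℝ) * (s ^ 2 / (4 * n)) = s ^ 2 / 4 := by field_simp
  nlinarith

/-- Pointwise domination of `s / |p_ζ|` by products of one-dimensional inverse square roots. -/
lemma ofReal_mul_inv_pAbs_le (hs : 1 ≤ s) (h₂ : ‖e₂‖ = 1) (h₁₂ : ⟪e₁, e₂⟫ = 0)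
    (b : OrthonormalBasis (Fin n) ℝ (EuclideanSpace ℝ (Fin n))) {i : Fin n} (hb : b i = e₁)
    (ξ : EuclideanSpace ℝ (Fin n)) :
    ENNReal.ofReal s * (ENNReal.ofReal (pAbs s e₁ e₂ ξ))⁻¹ ≤
      2 + ∑ j ∈ Finset.univ.erase i, ENNReal.ofReal n *
        (invSqrtAbs ⟪e₁, ξ⟫ * invSqrtAbs
            (⟪b j, ξ⟫ - (⟪b j, s • e₂⟫ + sliceRadius s (s • e₂) (b j) ξ)) +
          invSqrtAbs ⟪e₁, ξ⟫ * invSqrtAbs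
            (⟪b j, ξ⟫ - (⟪b j, s • e₂⟫ + -sliceRadius s (s • e₂) (b j) ξ))) := by
  have hs0 : 0 < s := by linarith
  have hp0 := pAbs_nonneg s e₁ e₂ ξ
  rcases le_or_gt (s / 2) (pAbs s e₁ e₂ ξ) with hp | hp
  · refine le_add_right ?_
    have hp' : 0 < pAbs s e₁ e₂ ξ := by linarith
    rw [← ENNReal.ofReal_inv_of_pos hp', ← ENNReal.ofReal_mul hs0.le, ← div_eq_mul_inv,
      ← ENNReal.ofReal_ofNat]
    refine ENNReal.ofReal_le_ofReal ?_
    rw [div_le_iff₀ hp']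
    linarith
  obtain ⟨j, hji, hj⟩ := exists_le_mul_abs_inner hs h₂ h₁₂ b hb hp
  have hn : (1 : ℝ) ≤ n := by exact_mod_cast i.pos
  refine le_add_left ?_
  refine le_trans ?_ (Finset.single_le_sum_of_canonicallyOrdered
    (Finset.mem_erase.2 ⟨hji, Finset.mem_univ j⟩))
  have hy : ‖ξ - s • e₂‖ ^ 2 = ‖ξ‖ ^ 2 - 2 * s * ⟪e₂, ξ⟫ + s ^ 2 := by
    rw [norm_sub_sq_real, inner_smul_right, norm_smul, h₂, real_inner_comm e₂ ξ, Real.norm_eq_abs,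
      mul_one, sq_abs]
    ring
  have hsub : ∀ t, ⟪b j, ξ⟫ - (⟪b j, s • e₂⟫ + t) = ⟪b j, ξ - s • e₂⟫ - t := fun t => by
    rw [inner_sub_right]; ring
  rw [hsub, hsub, sliceRadius]
  set x := ⟪b j, ξ - s • e₂⟫
  set A := s ^ 2 - (‖ξ - s • e₂‖ ^ 2 - x ^ 2) with hA
  have hxA : x ^ 2 - A = ‖ξ‖ ^ 2 - 2 * s * ⟪e₂, ξ⟫ := by rw [hA, hy]; ring
  have key : ∀ t, |x| * |t| ≤ |x ^ 2 - A| →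
      ENNReal.ofReal s * (ENNReal.ofReal (pAbs s e₁ e₂ ξ))⁻¹ ≤
        ENNReal.ofReal n * (invSqrtAbs ⟪e₁, ξ⟫ * invSqrtAbs t) := fun t ht => by
    refine ofReal_mul_inv_le_mul_invSqrtAbs hs0 (by linarith) hp0 ?_
    rw [mul_pow, sq_pAbs, ← hxA]
    have amgm : 4 * s * (|⟪e₁, ξ⟫| * |x ^ 2 - A|) ≤ (x ^ 2 - A) ^ 2 + (2 * s * ⟪e₁, ξ⟫) ^ 2 := by
      have := sq_nonneg (|x ^ 2 - A| - 2 * s * |⟪e₁, ξ⟫|)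
      nlinarith [sq_abs (x ^ 2 - A), sq_abs ⟪e₁, ξ⟫]
    calc s ^ 2 * (|⟪e₁, ξ⟫| * |t|) = s * |⟪e₁, ξ⟫| * |t| * s := by ring
      _ ≤ s * |⟪e₁, ξ⟫| * |t| * (2 * n * |x|) := by gcongr
      _ = 2 * n * (s * (|⟪e₁, ξ⟫| * (|x| * |t|))) := by ring
      _ ≤ 4 * n ^ 2 * (s * (|⟪e₁, ξ⟫| * |x ^ 2 - A|)) := by
        refine mul_le_mul ?_ (by gcongr) (by positivity) (by positivity)
        nlinarith
      _ = n ^ 2 * (4 * s * (|⟪e₁, ξ⟫| * |x ^ 2 - A|)) := by ring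
      _ ≤ _ := by gcongr
  rcases exists_abs_mul_abs_sub_le x A with h | h
  · exact (key _ h).trans (by gcongr; exact le_self_add)
  · exact (key _ h).trans (by gcongr; exact le_add_self)

end Symbol

section Kernel

variable {n : ℕ}

lemma lintegral_one_add_norm_pow_inv_lt_top (n : ℕ) :
    ∫⁻ x : EuclideanSpace ℝ (Fin n), ENNReal.ofReal ((1 + ‖x‖) ^ (n + 1))⁻¹ < ∞ := by
  have h := finite_integral_one_add_norm (E := EuclideanSpace ℝ (Fin n)) (μ := volume)
    (r := (n + 1 : ℕ)) (by simp)
  refine lt_of_le_of_lt (lintegral_mono fun x => ?_) h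
  rw [Real.rpow_neg (by positivity), Real.rpow_natCast]

/-- Uniform bound for the integral of `s / |p_ζ|` against translates of a decaying weight. -/
lemma exists_lintegral_mul_inv_pAbs_le (n : ℕ) :
    ∃ K : ℝ≥0∞, K < ∞ ∧ ∀ s ≥ (1 : ℝ), ∀ e₁ e₂ : EuclideanSpace ℝ (Fin n),
      ‖e₁‖ = 1 → ‖e₂‖ = 1 → ⟪e₁, e₂⟫ = 0 → ∀ η,
        ∫⁻ ξ, ENNReal.ofReal ((1 + ‖ξ - η‖) ^ (n + 1))⁻¹ *
          (ENNReal.ofReal s * (ENNReal.ofReal (pAbs s e₁ e₂ ξ))⁻¹) ≤ K := by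
  obtain ⟨H, hH, hHle⟩ := exists_lintegral_invSqrtAbs_le
  have hI := lintegral_one_add_norm_pow_inv_lt_top n
  set I := ∫⁻ x : EuclideanSpace ℝ (Fin n), ENNReal.ofReal ((1 + ‖x‖) ^ (n + 1))⁻¹ with hIdef
  set B := (2 ^ (n + 1) * H) ^ 2 * I with hB
  have hBtop : B < ∞ := ENNReal.mul_lt_top
    (ENNReal.pow_lt_top (ENNReal.mul_lt_top (ENNReal.pow_lt_top (by simp)) hH)) hI
  refine ⟨I * 2 + ∑ _ : Fin n, ENNReal.ofReal n * (B + B), ?_, ?_⟩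
  · refine ENNReal.add_lt_top.2 ⟨ENNReal.mul_lt_top hI (by simp), ENNReal.sum_lt_top.2 fun _ _ => ?_⟩
    exact ENNReal.mul_lt_top (by simp) (ENNReal.add_lt_top.2 ⟨hBtop, hBtop⟩)
  intro s hs e₁ e₂ h₁ h₂ h₁₂ η
  have hn : 0 < n := by
    rcases Nat.eq_zero_or_pos n with rfl | h
    · simp [Subsingleton.elim e₁ 0] at h₁
    · exact h
  obtain ⟨b, hb⟩ := Orthonormal.exists_orthonormalBasis_extension_of_card_eq (𝕜 := ℝ)
    (E := EuclideanSpace ℝ (Fin n)) (ι := Fin n) (by simp) (v := fun _ => e₁)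
    (s := {⟨0, hn⟩}) ⟨fun _ => by simpa using h₁, fun x y hxy => (hxy (Subsingleton.elim x y)).elim⟩
  have hb0 : b ⟨0, hn⟩ = e₁ := hb _ rfl
  set i : Fin n := ⟨0, hn⟩
  have hm := measurable_invSqrtAbs
  have hterm : ∀ j ≠ i, ∀ σ : ℝ,
      ∫⁻ ξ, ENNReal.ofReal ((1 + ‖ξ - η‖) ^ (n + 1))⁻¹ * (invSqrtAbs ⟪e₁, ξ⟫ * invSqrtAbs
        (⟪b j, ξ⟫ - (⟪b j, s • e₂⟫ + σ * sliceRadius s (s • e₂) (b j) ξ))) ≤ B := by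
    intro j hj σ
    have hortho : ⟪e₁, b j⟫ = 0 := by
      rw [← hb0, b.inner_eq_ite, if_neg hj.symm]
    refine lintegral_invSqrtAbs_mul_invSqrtAbs_le hHle (n + 1) η (b j) e₁ (b.norm_eq_one j) h₁
      hortho (α := fun ξ => ⟪b j, s • e₂⟫ + σ * sliceRadius s (s • e₂) (b j) ξ)
      (by fun_prop) fun x r => ?_
    simp only [sliceRadius_add_smul s (s • e₂) (b.norm_eq_one j)]
  calc ∫⁻ ξ, ENNReal.ofReal ((1 + ‖ξ - η‖) ^ (n + 1))⁻¹ *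
          (ENNReal.ofReal s * (ENNReal.ofReal (pAbs s e₁ e₂ ξ))⁻¹)
      ≤ ∫⁻ ξ, (ENNReal.ofReal ((1 + ‖ξ - η‖) ^ (n + 1))⁻¹ * 2 +
        ∑ j ∈ Finset.univ.erase i, ENNReal.ofReal n *
          (ENNReal.ofReal ((1 + ‖ξ - η‖) ^ (n + 1))⁻¹ * (invSqrtAbs ⟪e₁, ξ⟫ * invSqrtAbs
            (⟪b j, ξ⟫ - (⟪b j, s • e₂⟫ + 1 * sliceRadius s (s • e₂) (b j) ξ))) +
          ENNReal.ofReal ((1 + ‖ξ - η‖) ^ (n + 1))⁻¹ * (invSqrtAbs ⟪e₁, ξ⟫ * invSqrtAbs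
            (⟪b j, ξ⟫ - (⟪b j, s • e₂⟫ + (-1) * sliceRadius s (s • e₂) (b j) ξ))))) := by
        refine lintegral_mono fun ξ => ?_
        refine (mul_le_mul_right (ofReal_mul_inv_pAbs_le hs h₂ h₁₂ b hb0 ξ) _).trans_eq ?_
        rw [mul_add, Finset.mul_sum]
        congr 1
        refine Finset.sum_congr rfl fun j _ => ?_
        rw [one_mul, neg_one_mul]
        ring
    _ = (∫⁻ ξ, ENNReal.ofReal ((1 + ‖ξ - η‖) ^ (n + 1))⁻¹) * 2 +
        ∑ j ∈ Finset.univ.erase i, ENNReal.ofReal n *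
          ((∫⁻ ξ, ENNReal.ofReal ((1 + ‖ξ - η‖) ^ (n + 1))⁻¹ * (invSqrtAbs ⟪e₁, ξ⟫ * invSqrtAbs
            (⟪b j, ξ⟫ - (⟪b j, s • e₂⟫ + 1 * sliceRadius s (s • e₂) (b j) ξ)))) +
          ∫⁻ ξ, ENNReal.ofReal ((1 + ‖ξ - η‖) ^ (n + 1))⁻¹ * (invSqrtAbs ⟪e₁, ξ⟫ * invSqrtAbs
            (⟪b j, ξ⟫ - (⟪b j, s • e₂⟫ + (-1) * sliceRadius s (s • e₂) (b j) ξ)))) := by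
        rw [lintegral_add_left (by fun_prop), lintegral_mul_const _ (by fun_prop),
          lintegral_finsetSum _ (fun j _ => by fun_prop)]
        congr 1
        refine Finset.sum_congr rfl fun j _ => ?_
        rw [lintegral_const_mul _ (by fun_prop), lintegral_add_left (by fun_prop)]
    _ ≤ I * 2 + ∑ _j ∈ Finset.univ.erase i, ENNReal.ofReal n * (B + B) := by
        rw [lintegral_sub_right_eq_self
          (fun x : EuclideanSpace ℝ (Fin n) => ENNReal.ofReal ((1 + ‖x‖) ^ (n + 1))⁻¹) η]
        gcongr with j hj
        · exact hterm j (Finset.ne_of_mem_erase hj) 1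
        · exact hterm j (Finset.ne_of_mem_erase hj) (-1)
    _ ≤ _ := by
        gcongr
        exact Finset.erase_subset _ _

/-- Schur-type bound: convolution with a Schwartz function maps the weight `|p_ζ|⁻¹` to a multiple
of the weight `(s + |p_ζ|)⁻¹`. -/
lemma exists_lintegral_enorm_mul_inv_pAbs_le (f : SchwartzMap (EuclideanSpace ℝ (Fin n)) ℂ) :
    ∃ K : ℝ≥0∞, K < ∞ ∧ ∀ s ≥ (1 : ℝ), ∀ e₁ e₂ : EuclideanSpace ℝ (Fin n),
      ‖e₁‖ = 1 → ‖e₂‖ = 1 → ⟪e₁, e₂⟫ = 0 → ∀ η,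
        ∫⁻ ξ, (ENNReal.ofReal (pAbs s e₁ e₂ ξ))⁻¹ * ‖f (ξ - η)‖ₑ ≤
          K * (ENNReal.ofReal (s + pAbs s e₁ e₂ η))⁻¹ := by
  obtain ⟨K, hK, hKle⟩ := exists_lintegral_mul_inv_pAbs_le n
  have hI := lintegral_one_add_norm_pow_inv_lt_top n
  set I := ∫⁻ x : EuclideanSpace ℝ (Fin n), ENNReal.ofReal ((1 + ‖x‖) ^ (n + 1))⁻¹ with hIdef
  obtain ⟨M, hM0, hM⟩ : ∃ M : ℝ, 0 ≤ M ∧ ∀ x, (1 + ‖x‖) ^ (n + 3) * ‖f x‖ ≤ M := by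
    have h := fun x => f.one_add_le_sup_seminorm_apply (𝕜 := ℝ) (m := (n + 3, 0)) le_rfl le_rfl x
    simp only [norm_iteratedFDeriv_zero] at h
    exact ⟨_, le_trans (by positivity) (h 0), h⟩
  refine ⟨ENNReal.ofReal (12 * M) * (K + I),
    ENNReal.mul_lt_top ENNReal.ofReal_lt_top (ENNReal.add_lt_top.2 ⟨hK, hI⟩), ?_⟩
  intro s hs e₁ e₂ h₁ h₂ h₁₂ η
  have hpη := pAbs_nonneg s e₁ e₂ η
  have hpos : 0 < s + pAbs s e₁ e₂ η := by linarith
  calc ∫⁻ ξ, (ENNReal.ofReal (pAbs s e₁ e₂ ξ))⁻¹ * ‖f (ξ - η)‖ₑ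
      ≤ ∫⁻ ξ, ENNReal.ofReal (12 * M) * (ENNReal.ofReal (s + pAbs s e₁ e₂ η))⁻¹ *
        (ENNReal.ofReal ((1 + ‖ξ - η‖) ^ (n + 1))⁻¹ *
          (ENNReal.ofReal s * (ENNReal.ofReal (pAbs s e₁ e₂ ξ))⁻¹) +
          ENNReal.ofReal ((1 + ‖ξ - η‖) ^ (n + 1))⁻¹) := by
        refine lintegral_mono fun ξ => ?_
        have hpξ := pAbs_nonneg s e₁ e₂ ξ
        have hslow := add_pAbs_le hs h₁ h₂ ξ η
        have hf : ‖f (ξ - η)‖ ≤ 12 * M * (s + pAbs s e₁ e₂ η)⁻¹ *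
            (((1 + ‖ξ - η‖) ^ (n + 1))⁻¹ * (s + pAbs s e₁ e₂ ξ)) := by
          have e : 12 * M * (s + pAbs s e₁ e₂ η)⁻¹ *
            (((1 + ‖ξ - η‖) ^ (n + 1))⁻¹ * (s + pAbs s e₁ e₂ ξ)) =
            12 * M * (s + pAbs s e₁ e₂ ξ) /
              ((s + pAbs s e₁ e₂ η) * (1 + ‖ξ - η‖) ^ (n + 1)) := by
            field_simp
          rw [e, le_div_iff₀ (by positivity)]
          calc ‖f (ξ - η)‖ * ((s + pAbs s e₁ e₂ η) * (1 + ‖ξ - η‖) ^ (n + 1))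
              ≤ ‖f (ξ - η)‖ * ((12 * (1 + ‖ξ - η‖) ^ 2 * (s + pAbs s e₁ e₂ ξ)) *
                (1 + ‖ξ - η‖) ^ (n + 1)) := by gcongr
            _ = 12 * ((1 + ‖ξ - η‖) ^ (n + 3) * ‖f (ξ - η)‖) * (s + pAbs s e₁ e₂ ξ) := by ring
            _ ≤ 12 * M * (s + pAbs s e₁ e₂ ξ) := by
              gcongr
              exact hM _
        have hf' := ENNReal.ofReal_le_ofReal hf
        rw [ofReal_norm, ENNReal.ofReal_mul (by positivity),
          ENNReal.ofReal_mul (p := 12 * M) (by positivity),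
          ENNReal.ofReal_mul (p := ((1 + ‖ξ - η‖) ^ (n + 1))⁻¹) (by positivity),
          ENNReal.ofReal_inv_of_pos hpos, ENNReal.ofReal_add (by linarith) hpξ] at hf'
        calc (ENNReal.ofReal (pAbs s e₁ e₂ ξ))⁻¹ * ‖f (ξ - η)‖ₑ
            ≤ (ENNReal.ofReal (pAbs s e₁ e₂ ξ))⁻¹ * _ := mul_le_mul_right hf' _
          _ = ENNReal.ofReal (12 * M) * (ENNReal.ofReal (s + pAbs s e₁ e₂ η))⁻¹ *
              (ENNReal.ofReal ((1 + ‖ξ - η‖) ^ (n + 1))⁻¹ *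
              (ENNReal.ofReal s * (ENNReal.ofReal (pAbs s e₁ e₂ ξ))⁻¹) +
              ENNReal.ofReal ((1 + ‖ξ - η‖) ^ (n + 1))⁻¹ *
              (ENNReal.ofReal (pAbs s e₁ e₂ ξ) * (ENNReal.ofReal (pAbs s e₁ e₂ ξ))⁻¹)) := by
            ring
          _ ≤ _ := by
            gcongr
            exact mul_le_of_le_one_right' (ENNReal.mul_inv_le_one _)
    _ = ENNReal.ofReal (12 * M) * (ENNReal.ofReal (s + pAbs s e₁ e₂ η))⁻¹ *
        ((∫⁻ ξ, ENNReal.ofReal ((1 + ‖ξ - η‖) ^ (n + 1))⁻¹ *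
          (ENNReal.ofReal s * (ENNReal.ofReal (pAbs s e₁ e₂ ξ))⁻¹)) +
          ∫⁻ ξ, ENNReal.ofReal ((1 + ‖ξ - η‖) ^ (n + 1))⁻¹) := by
        rw [lintegral_const_mul _ (by fun_prop), lintegral_add_left (by fun_prop)]
    _ ≤ ENNReal.ofReal (12 * M) * (ENNReal.ofReal (s + pAbs s e₁ e₂ η))⁻¹ * (K + I) := by
        rw [lintegral_sub_right_eq_self
          (fun x : EuclideanSpace ℝ (Fin n) => ENNReal.ofReal ((1 + ‖x‖) ^ (n + 1))⁻¹) η]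
        gcongr
        exact hKle s hs e₁ e₂ h₁ h₂ h₁₂ η
    _ = _ := by ring

end Kernel

section Convolution

variable {E : Type*} [NormedAddCommGroup E] [InnerProductSpace ℝ E] [FiniteDimensional ℝ E]
  [MeasurableSpace E] [BorelSpace E]

/-- The Fourier transform of a product of Schwartz functions is the convolution of their Fourier
transforms. -/
lemma SchwartzMap.fourier_mul_eq_convolution (f g : SchwartzMap E ℂ) (ξ : E) :
    𝓕 (fun x => f x * g x) ξ = ∫ t, 𝓕 f t * 𝓕 g (ξ - t) := by
  have hfl : ∀ (h : SchwartzMap E ℂ) (x : E), 𝓕 (𝓕 h) (-x) = h x := fun h x => by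
    rw [SchwartzMap.fourier_coe, ← Real.fourierInv_eq_fourier_neg, ← SchwartzMap.fourierInv_coe,
      FourierTransform.fourierInv_fourier_eq]
  have h1 := SchwartzMap.convolution_apply (ContinuousLinearMap.mul ℂ ℂ) (𝓕 f) (𝓕 g) ξ
  have h2 : SchwartzMap.convolution (ContinuousLinearMap.mul ℂ ℂ) (𝓕 f) (𝓕 g) =
      𝓕⁻ (SchwartzMap.pairing (ContinuousLinearMap.mul ℂ ℂ) (𝓕 (𝓕 f)) (𝓕 (𝓕 g))) := rfl
  rw [h2, SchwartzMap.fourierInv_coe, Real.fourierInv_eq_fourier_comp_neg] at h1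
  simp only [SchwartzMap.pairing_apply_apply, hfl, ContinuousLinearMap.mul_apply'] at h1
  rw [h1]
  rfl

lemma sq_lintegral_mul_le {α : Type*} [MeasurableSpace α] {μ : Measure α} {f g : α → ℝ≥0∞}
    (hf : Measurable f) (hg : Measurable g) :
    (∫⁻ x, f x * g x ∂μ) ^ 2 ≤ (∫⁻ x, f x ∂μ) * ∫⁻ x, f x * g x ^ 2 ∂μ := by
  have h := ENNReal.lintegral_mul_norm_pow_le (μ := μ) (f := f) (g := fun x => f x * g x ^ 2)
    (p := 1 / 2) (q := 1 / 2) (by fun_prop) (by fun_prop) (by norm_num) (by norm_num) (by norm_num)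
  have hsq : ∀ a : ℝ≥0∞, (a ^ (1 / 2 : ℝ)) ^ 2 = a := fun a => by
    rw [← ENNReal.rpow_natCast, ← ENNReal.rpow_mul]; norm_num
  have hsq' : ∀ a : ℝ≥0∞, (a ^ 2) ^ (1 / 2 : ℝ) = a := fun a => by
    rw [← ENNReal.rpow_natCast, ← ENNReal.rpow_mul]; norm_num
  have e : ∀ x, f x ^ (1 / 2 : ℝ) * (f x * g x ^ 2) ^ (1 / 2 : ℝ) = f x * g x := fun x => by
    rw [ENNReal.mul_rpow_of_nonneg _ _ (by norm_num), hsq', ← mul_assoc, ← pow_two, hsq]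
  simp only [e] at h
  calc _ ≤ _ := pow_le_pow_left₀ zero_le h 2
    _ = _ := by rw [mul_pow, hsq, hsq]

lemma SchwartzMap.sq_enorm_fourier_mul_le (f g : SchwartzMap E ℂ) (ξ : E) :
    ‖𝓕 (fun x => f x * g x) ξ‖ₑ ^ 2 ≤
      (∫⁻ t, ‖𝓕 f t‖ₑ) * ∫⁻ η, ‖𝓕 f (ξ - η)‖ₑ * ‖𝓕 g η‖ₑ ^ 2 := by
  have hf : Measurable fun t => ‖𝓕 f t‖ₑ := (𝓕 f).continuous.enorm.measurable
  have hg : Measurable fun t => ‖𝓕 g (ξ - t)‖ₑ :=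
    ((𝓕 g).continuous.comp (by fun_prop)).enorm.measurable
  calc ‖𝓕 (fun x => f x * g x) ξ‖ₑ ^ 2
      ≤ (∫⁻ t, ‖𝓕 f t‖ₑ * ‖𝓕 g (ξ - t)‖ₑ) ^ 2 := by
        rw [SchwartzMap.fourier_mul_eq_convolution]
        gcongr
        refine (enorm_integral_le_lintegral_enorm _).trans_eq ?_
        simp only [enorm_mul]
    _ ≤ (∫⁻ t, ‖𝓕 f t‖ₑ) * ∫⁻ t, ‖𝓕 f t‖ₑ * ‖𝓕 g (ξ - t)‖ₑ ^ 2 :=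
        sq_lintegral_mul_le hf hg
    _ = _ := by
        rw [← lintegral_sub_left_eq_self (fun t => ‖𝓕 f t‖ₑ * ‖𝓕 g (ξ - t)‖ₑ ^ 2) ξ]
        simp

end Convolution

/-- `‖Φu‖_{Ẋ^{-1/2}_ζ} ≲ ‖u‖_{X^{-1/2}_ζ}` uniformly over `s ≥ 1` and
orthonormal `e₁, e₂`, for a fixed Schwartz cutoff `Φ`; both sides are Lebesgue integrals
with values in `[0,∞]`. -/
theorem stmt_12 (n : ℕ) (hn : 2 ≤ n)
    (Φ : SchwartzMap (EuclideanSpace ℝ (Fin n)) ℂ) :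
    ∃ C > 0, ∀ s ≥ (1 : ℝ), ∀ e₁ e₂ : EuclideanSpace ℝ (Fin n),
      ‖e₁‖ = 1 → ‖e₂‖ = 1 → ⟪e₁, e₂⟫ = 0 →
      ∀ u : SchwartzMap (EuclideanSpace ℝ (Fin n)) ℂ,
        ∫⁻ ξ, (ENNReal.ofReal (pAbs s e₁ e₂ ξ))⁻¹ *
            ENNReal.ofReal (‖𝓕 (fun x => Φ x * u x) ξ‖ ^ 2) ≤
          ENNReal.ofReal C *
            ∫⁻ ξ, (ENNReal.ofReal (s + pAbs s e₁ e₂ ξ))⁻¹ *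
              ENNReal.ofReal (‖𝓕 (⇑u) ξ‖ ^ 2) := by
  obtain ⟨K, hK, hKle⟩ := exists_lintegral_enorm_mul_inv_pAbs_le (𝓕 Φ)
  have hmul := fun u => Φ.sq_enorm_fourier_mul_le u
  generalize 𝓕 Φ = A at hKle hmul
  have hA : Measurable A := A.continuous.measurable
  set L := ∫⁻ t, ‖A t‖ₑ with hL
  have hLtop : L < ∞ := A.integrable.2
  have hLK : L * K ≤ ENNReal.ofReal ((L * K).toReal + 1) := by
    rw [← ENNReal.ofReal_toReal (ENNReal.mul_lt_top hLtop hK).ne]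
    exact ENNReal.ofReal_le_ofReal (by simp)
  refine ⟨(L * K).toReal + 1, by positivity, fun s hs e₁ e₂ h₁ h₂ h₁₂ u => ?_⟩
  have hofReal : ∀ z : ℂ, ENNReal.ofReal (‖z‖ ^ 2) = ‖z‖ₑ ^ 2 := fun z => by
    rw [ENNReal.ofReal_pow (norm_nonneg z), ofReal_norm]
  simp only [hofReal, ← SchwartzMap.fourier_coe u]
  specialize hmul u
  generalize 𝓕 u = B at hmul ⊢
  have hB : Measurable B := B.continuous.measurable
  calc ∫⁻ ξ, (ENNReal.ofReal (pAbs s e₁ e₂ ξ))⁻¹ * ‖𝓕 (fun x => Φ x * u x) ξ‖ₑ ^ 2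
      ≤ ∫⁻ ξ, (ENNReal.ofReal (pAbs s e₁ e₂ ξ))⁻¹ *
          (L * ∫⁻ η, ‖A (ξ - η)‖ₑ * ‖B η‖ₑ ^ 2) := by
        gcongr with ξ
        exact hmul ξ
    _ = ∫⁻ ξ, ∫⁻ η, L * ((ENNReal.ofReal (pAbs s e₁ e₂ ξ))⁻¹ * ‖A (ξ - η)‖ₑ *
          ‖B η‖ₑ ^ 2) := by
        refine lintegral_congr fun ξ => ?_
        rw [lintegral_const_mul _ (by fun_prop), mul_left_comm, ← lintegral_const_mul _ (by fun_prop)]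
        simp only [mul_assoc]
    _ = ∫⁻ η, ∫⁻ ξ, L * ((ENNReal.ofReal (pAbs s e₁ e₂ ξ))⁻¹ * ‖A (ξ - η)‖ₑ *
          ‖B η‖ₑ ^ 2) := lintegral_lintegral_swap (by fun_prop)
    _ = ∫⁻ η, L * ((∫⁻ ξ, (ENNReal.ofReal (pAbs s e₁ e₂ ξ))⁻¹ * ‖A (ξ - η)‖ₑ) *
          ‖B η‖ₑ ^ 2) := by
        refine lintegral_congr fun η => ?_
        rw [lintegral_const_mul _ (by fun_prop), lintegral_mul_const _ (by fun_prop)]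
    _ ≤ ∫⁻ η, L * (K * (ENNReal.ofReal (s + pAbs s e₁ e₂ η))⁻¹ * ‖B η‖ₑ ^ 2) := by
        gcongr with η
        exact hKle s hs e₁ e₂ h₁ h₂ h₁₂ η
    _ = L * K * ∫⁻ η, (ENNReal.ofReal (s + pAbs s e₁ e₂ η))⁻¹ * ‖B η‖ₑ ^ 2 := by
        rw [← lintegral_const_mul _ (by fun_prop)]
        simp only [mul_assoc]
    _ ≤ _ := by gcongr
end

section
/- Let n ≥ 1, let η ∈ ℝⁿ be a unit vector, and let t > 0. For every real-valued smooth compactly supported function u : ℝⁿ → ℝ, the exact identity holds: ∫_{ℝⁿ} |Δu + 2t η·∇u + t²u|² dx = ∫_{ℝⁿ} |Δu + t²u|² dx + 4t² ∫_{ℝⁿ} (η·∇u)² dx. In particular the cross terms between Δu + t²u and 2t η·∇u integrate to zero. -/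
open MeasureTheory

/-- The Laplacian of `u`, as the sum of second directional derivatives along the
standard basis of `EuclideanSpace ℝ (Fin n)`. -/
noncomputable def lap {n : ℕ} {F : Type*} [NormedAddCommGroup F] [NormedSpace ℝ F]
    (u : EuclideanSpace ℝ (Fin n) → F) (x : EuclideanSpace ℝ (Fin n)) : F :=
  ∑ i : Fin n, fderiv ℝ (fun y => fderiv ℝ u y (EuclideanSpace.single i 1)) x
    (EuclideanSpace.single i 1)

theorem Continuous.integrable_sq_of_hasCompactSupport {X : Type*} [TopologicalSpace X]
    [MeasurableSpace X] [OpensMeasurableSpace X] {μ : Measure X} [IsFiniteMeasureOnCompacts μ]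
    {f : X → ℝ} (hf : Continuous f) (hfc : HasCompactSupport f) :
    Integrable (fun x => f x ^ 2) μ := by
  simp only [pow_two]
  exact (hf.mul hf).integrable_of_hasCompactSupport hfc.mul_left

section DirectionalDerivative

variable {E : Type*} [NormedAddCommGroup E] [NormedSpace ℝ E]

theorem contDiff_fderiv_apply_const {u : E → ℝ} (hu : ContDiff ℝ (⊤ : ℕ∞) u) (v : E) :
    ContDiff ℝ (⊤ : ℕ∞) fun x => fderiv ℝ u x v :=
  (hu.fderiv_right (by simp)).clm_apply contDiff_const

theorem fderiv_fderiv_apply_comm {u : E → ℝ} (hu : ContDiff ℝ (⊤ : ℕ∞) u) (v w x : E) :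
    fderiv ℝ (fun y => fderiv ℝ u y v) x w = fderiv ℝ (fun y => fderiv ℝ u y w) x v := by
  have hd : DifferentiableAt ℝ (fderiv ℝ u) x :=
    ((hu.fderiv_right (m := (⊤ : ℕ∞)) (by simp)).differentiable (by simp)) x
  have hs : IsSymmSndFDerivAt ℝ u x :=
    hu.contDiffAt.isSymmSndFDerivAt (by simpa using WithTop.coe_le_coe.2 (le_top : (2 : ℕ∞) ≤ ⊤))
  rw [fderiv_clm_apply hd (differentiableAt_const v),
    fderiv_clm_apply hd (differentiableAt_const w)]
  simpa using hs.eq w v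

variable [FiniteDimensional ℝ E] [MeasurableSpace E] [BorelSpace E]
  (μ : Measure E) [μ.IsAddHaarMeasure]

theorem integral_mul_fderiv_of_hasCompactSupport {f g : E → ℝ}
    (hf : ContDiff ℝ (⊤ : ℕ∞) f) (hfc : HasCompactSupport f)
    (hg : ContDiff ℝ (⊤ : ℕ∞) g) (v : E) :
    ∫ x, f x * fderiv ℝ g x v ∂μ = -∫ x, fderiv ℝ f x v * g x ∂μ := by
  have hfv := hfc.fderiv_apply (𝕜 := ℝ) v
  refine integral_mul_fderiv_eq_neg_fderiv_mul_of_integrable ?_ ?_ ?_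
    (fun x _ => hf.differentiable (by simp) x) (fun x _ => hg.differentiable (by simp) x)
  · exact ((contDiff_fderiv_apply_const hf v).continuous.mul
      hg.continuous).integrable_of_hasCompactSupport hfv.mul_right
  · exact (hf.continuous.mul
      (contDiff_fderiv_apply_const hg v).continuous).integrable_of_hasCompactSupport hfc.mul_right
  · exact (hf.continuous.mul hg.continuous).integrable_of_hasCompactSupport hfc.mul_right

theorem integral_mul_fderiv_self_eq_zero {f : E → ℝ}
    (hf : ContDiff ℝ (⊤ : ℕ∞) f) (hfc : HasCompactSupport f) (v : E) :
    ∫ x, f x * fderiv ℝ f x v ∂μ = 0 := by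
  have h := integral_mul_fderiv_of_hasCompactSupport μ hf hfc hf v
  simp only [mul_comm (fderiv ℝ f _ v)] at h
  linarith

theorem integral_fderiv_fderiv_mul_fderiv_eq_zero {u : E → ℝ}
    (hu : ContDiff ℝ (⊤ : ℕ∞) u) (huc : HasCompactSupport u) (e v : E) :
    ∫ x, fderiv ℝ (fun y => fderiv ℝ u y e) x e * fderiv ℝ u x v ∂μ = 0 := by
  have hue := contDiff_fderiv_apply_const hu e
  have hec := huc.fderiv_apply (𝕜 := ℝ) e
  have h := integral_mul_fderiv_of_hasCompactSupport μ hue hec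
    (contDiff_fderiv_apply_const hu v) e
  simp only [fderiv_fderiv_apply_comm hu v e] at h
  rw [integral_mul_fderiv_self_eq_zero μ hue hec v] at h
  linarith

end DirectionalDerivative

theorem integral_lap_mul_fderiv_eq_zero {n : ℕ} {u : EuclideanSpace ℝ (Fin n) → ℝ}
    (hu : ContDiff ℝ (⊤ : ℕ∞) u) (huc : HasCompactSupport u) (v : EuclideanSpace ℝ (Fin n)) :
    ∫ x, lap u x * fderiv ℝ u x v = 0 := by
  simp only [lap, Finset.sum_mul]
  rw [integral_finsetSum]
  · exact Finset.sum_eq_zero fun i _ =>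
      integral_fderiv_fderiv_mul_fderiv_eq_zero volume hu huc _ v
  · intro i _
    exact Continuous.integrable_of_hasCompactSupport
      ((contDiff_fderiv_apply_const (contDiff_fderiv_apply_const hu _) _).continuous.mul
        (contDiff_fderiv_apply_const hu v).continuous) (huc.fderiv_apply (𝕜 := ℝ) v).mul_left

theorem contDiff_lap {n : ℕ} {u : EuclideanSpace ℝ (Fin n) → ℝ}
    (hu : ContDiff ℝ (⊤ : ℕ∞) u) : ContDiff ℝ (⊤ : ℕ∞) (lap u) :=
  ContDiff.sum fun _ _ => contDiff_fderiv_apply_const (contDiff_fderiv_apply_const hu _) _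

theorem hasCompactSupport_lap {n : ℕ} {u : EuclideanSpace ℝ (Fin n) → ℝ}
    (huc : HasCompactSupport u) : HasCompactSupport (lap u) := by
  refine huc.mono' fun x hx => ?_
  contrapose! hx
  refine Function.notMem_support.2 (Finset.sum_eq_zero fun i _ => ?_)
  have h : x ∉ tsupport fun y => fderiv ℝ u y (EuclideanSpace.single i 1) :=
    fun h => hx (tsupport_fderiv_apply_subset ℝ _ h)
  rw [fderiv_of_notMem_tsupport (𝕜 := ℝ) h]
  rfl

/-- Exact Carleman identity for the conjugated Laplacian with linear
weight: `∫ |Δu + 2tη·∇u + t²u|² = ∫ |Δu + t²u|² + 4t² ∫ (η·∇u)²` for smooth compactly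
supported real-valued `u`. -/
theorem stmt_15 (n : ℕ) (hn : 1 ≤ n)
    (η : EuclideanSpace ℝ (Fin n)) (hη : ‖η‖ = 1)
    (t : ℝ) (ht : 0 < t)
    (u : EuclideanSpace ℝ (Fin n) → ℝ) (hu : ContDiff ℝ (⊤ : ℕ∞) u)
    (huc : HasCompactSupport u) :
    ∫ x, (lap u x + 2 * t * fderiv ℝ u x η + t ^ 2 * u x) ^ 2 =
      (∫ x, (lap u x + t ^ 2 * u x) ^ 2) + 4 * t ^ 2 * ∫ x, (fderiv ℝ u x η) ^ 2 := by
  have hL := (contDiff_lap hu).continuous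
  have hLc := hasCompactSupport_lap huc
  have hD := (contDiff_fderiv_apply_const hu η).continuous
  have hDc := huc.fderiv_apply (𝕜 := ℝ) η
  have hA : Integrable fun x => (lap u x + t ^ 2 * u x) ^ 2 := by
    have hc : HasCompactSupport fun x => lap u x + t ^ 2 * u x :=
      hLc.add (huc.mul_left (f := fun _ => t ^ 2))
    exact (hL.add (hu.continuous.const_mul _)).integrable_sq_of_hasCompactSupport hc
  have hB : Integrable fun x => (fderiv ℝ u x η) ^ 2 :=
    hD.integrable_sq_of_hasCompactSupport hDc
  have hLD : Integrable fun x => lap u x * fderiv ℝ u x η :=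
    (hL.mul hD).integrable_of_hasCompactSupport hDc.mul_left
  have huD : Integrable fun x => u x * fderiv ℝ u x η :=
    (hu.continuous.mul hD).integrable_of_hasCompactSupport hDc.mul_left
  calc ∫ x, (lap u x + 2 * t * fderiv ℝ u x η + t ^ 2 * u x) ^ 2
      = ∫ x, (((lap u x + t ^ 2 * u x) ^ 2 + 4 * t ^ 2 * (fderiv ℝ u x η) ^ 2)
          + 4 * t * (lap u x * fderiv ℝ u x η)) + 4 * t ^ 3 * (u x * fderiv ℝ u x η) := by
        congr 1 with x
        ring
    _ = _ := by
        rw [integral_add ((hA.fun_add (hB.const_mul _)).fun_add (hLD.const_mul _)) (huD.const_mul _),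
          integral_add (hA.fun_add (hB.const_mul _)) (hLD.const_mul _),
          integral_add hA (hB.const_mul _)]
        simp only [integral_const_mul]
        rw [integral_lap_mul_fderiv_eq_zero hu huc η,
          integral_mul_fderiv_self_eq_zero volume hu huc η]
        ring
end

section
/- Let n ≥ 1 and let f : ℝⁿ → ℂ be an integrable function with compact support. If the Fourier transform 𝓕f vanishes on some nonempty open subset of ℝⁿ, then f = 0 almost everywhere. -/
open MeasureTheory
open scoped FourierTransform

/-- The exponential integral `∫ exp (z a) f` is entire in `z` when `f` is integrable and `a` is
bounded on the support of `f`. -/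
theorem differentiable_integral_cexp_mul {α : Type*} [MeasurableSpace α] {μ : Measure α}
    {a f : α → ℂ} (ha : AEStronglyMeasurable a μ) (hf : Integrable f μ) {M : ℝ}
    (hM : ∀ x, f x ≠ 0 → ‖a x‖ ≤ M) :
    Differentiable ℂ fun z : ℂ ↦ ∫ x, Complex.exp (z * a x) * f x ∂μ := by
  intro w
  have hmeas (z : ℂ) : AEStronglyMeasurable (fun x ↦ Complex.exp (z * a x) * f x) μ :=
    (Complex.continuous_exp.comp_aestronglyMeasurable (ha.const_mul z)).mul
      hf.aestronglyMeasurable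
  have hexp (z : ℂ) (x : α) (hx : f x ≠ 0) : ‖Complex.exp (z * a x)‖ ≤ Real.exp (‖z‖ * M) := by
    refine (Complex.norm_exp_le_exp_norm _).trans (Real.exp_le_exp.2 ?_)
    rw [norm_mul]
    exact mul_le_mul_of_nonneg_left (hM x hx) (norm_nonneg z)
  refine (hasDerivAt_integral_of_dominated_loc_of_deriv_le (𝕜 := ℂ)
    (F := fun z x ↦ Complex.exp (z * a x) * f x)
    (F' := fun z x ↦ Complex.exp (z * a x) * a x * f x)
    (bound := fun x ↦ Real.exp ((‖w‖ + 1) * M) * M * ‖f x‖)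
    (Metric.ball_mem_nhds w one_pos) (.of_forall hmeas) ?_ ?_ ?_ ?_ ?_).2.differentiableAt
  · refine (hf.norm.const_mul (Real.exp (‖w‖ * M))).mono' (hmeas w) (.of_forall fun x ↦ ?_)
    by_cases hx : f x = 0
    · simp [hx]
    rw [norm_mul]
    exact mul_le_mul_of_nonneg_right (hexp w x hx) (norm_nonneg _)
  · exact ((Complex.continuous_exp.comp_aestronglyMeasurable (ha.const_mul w)).mul ha).mul
      hf.aestronglyMeasurable
  · refine .of_forall fun x z hz ↦ ?_
    by_cases hx : f x = 0
    · simp [hx]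
    have hM0 : 0 ≤ M := (norm_nonneg _).trans (hM x hx)
    have hz' : ‖z‖ ≤ ‖w‖ + 1 := by
      have h₁ := norm_sub_norm_le z w
      have h₂ := mem_ball_iff_norm.1 hz
      linarith
    rw [norm_mul, norm_mul]
    gcongr
    · exact (hexp z x hx).trans (by gcongr)
    · exact hM x hx
  · exact hf.norm.const_mul _
  · refine .of_forall fun x z _ ↦ ?_
    simpa using (((hasDerivAt_id z).mul_const (a x)).cexp).mul_const (f x)

variable {V : Type*} [NormedAddCommGroup V] [InnerProductSpace ℝ V] [FiniteDimensional ℝ V]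
  [MeasurableSpace V] [BorelSpace V]

/-- The Fourier transform is injective on integrable functions. -/
theorem MeasureTheory.Integrable.ae_eq_zero_of_fourier_eq_zero {f : V → ℂ} (hf : Integrable f)
    (h : ∀ ξ, 𝓕 f ξ = 0) : f =ᵐ[volume] 0 := by
  refine ae_eq_zero_of_integral_contDiff_smul_eq_zero hf.locallyIntegrable fun g hg hgc ↦ ?_
  have hgc' : HasCompactSupport fun x ↦ (g x : ℂ) := hgc.comp_left Complex.ofReal_zero
  let G : SchwartzMap V ℂ := hgc'.toSchwartzMap (Complex.ofRealCLM.contDiff.comp hg)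
  have key := VectorFourier.integral_fourierIntegral_smul_eq_flip (L := innerₗ V)
    Real.continuous_fourierChar continuous_inner ((𝓕⁻ G).integrable (μ := volume)) hf
  rw [flip_innerₗ] at key
  change ∫ ξ, 𝓕 (𝓕⁻ G) ξ • f ξ = ∫ x, (𝓕⁻ G) x • 𝓕 f x at key
  rw [FourierTransform.fourier_fourierInv_eq] at key
  simp only [h, smul_zero, integral_zero] at key
  exact key

/-- The Fourier transform of a compactly supported integrable function vanishes identically as
soon as it vanishes on a nonempty open set. -/
theorem HasCompactSupport.fourier_eq_zero_of_isOpen {f : V → ℂ} (hfc : HasCompactSupport f)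
    (hf : Integrable f) {U : Set V} (hU : IsOpen U) (hUne : U.Nonempty)
    (hvanish : ∀ ξ ∈ U, 𝓕 f ξ = 0) (ξ : V) : 𝓕 f ξ = 0 := by
  obtain ⟨ξ₀, hξ₀⟩ := hUne
  obtain ⟨R, hR⟩ := hfc.isCompact.isBounded.exists_norm_le
  let a : V → ℂ := fun x ↦ (↑(-2 * Real.pi * inner ℝ x (ξ - ξ₀)) : ℂ) * Complex.I
  let k : V → ℂ := fun x ↦ Complex.exp (↑(-2 * Real.pi * inner ℝ x ξ₀) * Complex.I) * f x
  have hk : Integrable k := by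
    refine ((Real.fourierIntegral_convergent_iff ξ₀).2 hf).congr (.of_forall fun x ↦ ?_)
    simp [k, Circle.smul_def, Real.fourierChar_apply]
  have ha : Continuous a := by fun_prop
  have haM (x : V) (hx : k x ≠ 0) : ‖a x‖ ≤ 2 * Real.pi * (R * ‖ξ - ξ₀‖) := by
    have hxR := hR x (subset_tsupport f (right_ne_zero_of_mul hx))
    have : ‖a x‖ = 2 * Real.pi * |inner ℝ x (ξ - ξ₀)| := by
      simp [a, abs_of_pos Real.pi_pos]
    rw [this]
    gcongr
    exact (abs_real_inner_le_norm _ _).trans (by gcongr)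
  have hd := differentiable_integral_cexp_mul ha.aestronglyMeasurable hk haM
  set g : ℂ → ℂ := fun z ↦ ∫ x, Complex.exp (z * a x) * k x
  have hg (t : ℝ) : g t = 𝓕 f (ξ₀ + t • (ξ - ξ₀)) := by
    rw [Real.fourier_eq']
    refine integral_congr_ae (.of_forall fun x ↦ ?_)
    simp only [a, k, smul_eq_mul, ← mul_assoc, ← Complex.exp_add, inner_add_right,
      inner_smul_right]
    congr 2
    push_cast
    ring
  have hline : ∀ᶠ t : ℝ in nhdsWithin 0 {0}ᶜ, g t = 0 := by
    have hc : Continuous fun t : ℝ ↦ ξ₀ + t • (ξ - ξ₀) := by fun_prop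
    have := hc.continuousAt.preimage_mem_nhds (x := 0) (hU.mem_nhds (by simpa using hξ₀))
    filter_upwards [nhdsWithin_le_nhds this] with t ht
    rw [hg, hvanish _ ht]
  have hofReal : Filter.Tendsto (fun t : ℝ ↦ (t : ℂ)) (nhdsWithin 0 {0}ᶜ)
      (nhdsWithin 0 {0}ᶜ) := by
    refine tendsto_nhdsWithin_iff.2 ⟨?_, ?_⟩
    · exact (Complex.continuous_ofReal.tendsto' 0 0 Complex.ofReal_zero).mono_left
        nhdsWithin_le_nhds
    · filter_upwards [self_mem_nhdsWithin] with t ht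
      simpa using ht
  have hzero := (hd.differentiableOn.analyticOnNhd isOpen_univ)
    |>.eqOn_zero_of_preconnected_of_frequently_eq_zero isPreconnected_univ (Set.mem_univ 0)
      (hofReal.frequently hline.frequently)
  simpa [hzero (Set.mem_univ 1)] using (hg 1).symm

/-- Paley–Wiener-type uniqueness: if an integrable compactly supported
function on `ℝⁿ` has Fourier transform vanishing on a nonempty open set, then it vanishes
almost everywhere. -/
theorem stmt_18 (n : ℕ) (hn : 1 ≤ n)
    (f : EuclideanSpace ℝ (Fin n) → ℂ)
    (hf : Integrable f) (hfc : HasCompactSupport f)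
    (U : Set (EuclideanSpace ℝ (Fin n))) (hU : IsOpen U) (hUne : U.Nonempty)
    (hvanish : ∀ ξ ∈ U, 𝓕 f ξ = 0) :
    f =ᵐ[volume] 0 :=
  hf.ae_eq_zero_of_fourier_eq_zero (hfc.fourier_eq_zero_of_isOpen hf hU hUne hvanish)
end

section
/- Let n ≥ 1, let Ω ⊂ ℝⁿ be a bounded open set, and let w₁, w₂ : ℝⁿ → ℝ be continuously differentiable functions with w₁ = w₂ on ℝⁿ \ Ω. Suppose that for every smooth compactly supported test function φ with support in Ω: ∫_Ω [ (1/2)(w₁ − w₂) Δφ + (1/4)(‖∇w₁‖² − ‖∇w₂‖²) φ ] dx = 0 (i.e., (1/2)Δ(w₁ − w₂) + (1/4)(‖∇w₁‖² − ‖∇w₂‖²) = 0 in Ω in the sense of distributions). Then w₁ = w₂ on all of ℝⁿ. -/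
open MeasureTheory

open scoped Convolution in
/-- A compactly supported `C¹` function is approximated in `C¹` norm by smooth functions supported
near its support. -/
theorem exists_contDiff_forall_norm_fderiv_sub_le {E : Type*} [NormedAddCommGroup E]
    [InnerProductSpace ℝ E] [FiniteDimensional ℝ E] [MeasurableSpace E] [BorelSpace E]
    {φ : E → ℝ} (hφ : ContDiff ℝ 1 φ) (hc : HasCompactSupport φ) {δ ε : ℝ} (hδ : 0 < δ)
    (hε : 0 < ε) :
    ∃ ψ : E → ℝ, ContDiff ℝ (⊤ : ℕ∞) ψ ∧ tsupport ψ ⊆ Metric.cthickening δ (tsupport φ) ∧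
      (∀ x, |ψ x - φ x| ≤ ε) ∧ ∀ x, ‖fderiv ℝ ψ x - fderiv ℝ φ x‖ ≤ ε := by
  have hφ' : Continuous (fderiv ℝ φ) := hφ.continuous_fderiv one_ne_zero
  obtain ⟨δ₁, hδ₁, h₁⟩ := Metric.uniformContinuous_iff.1
    (hc.uniformContinuous_of_continuous hφ.continuous) ε hε
  obtain ⟨δ₂, hδ₂, h₂⟩ := Metric.uniformContinuous_iff.1
    ((hc.fderiv (𝕜 := ℝ)).uniformContinuous_of_continuous hφ') ε hε
  set r := min δ (min δ₁ δ₂)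
  have hrpos : 0 < r := by positivity
  let ρ : ContDiffBump (0 : E) := ⟨r / 2, r, by positivity, by linarith⟩
  have hρ : ContDiff ℝ (⊤ : ℕ∞) (ρ.normed (volume : Measure E)) := ρ.contDiff_normed
  have hlsmul : (ContinuousLinearMap.lsmul ℝ ℝ : ℝ →L[ℝ] ℝ →L[ℝ] ℝ).precompR E =
      ContinuousLinearMap.lsmul ℝ ℝ := by
    ext; simp
  have hd (x : E) := hc.hasFDerivAt_convolution_right (ContinuousLinearMap.lsmul ℝ ℝ)
    (hρ.continuous.locallyIntegrable (μ := volume)) hφ x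
  rw [hlsmul] at hd
  refine ⟨ρ.normed volume ⋆[ContinuousLinearMap.lsmul ℝ ℝ, volume] φ, ?_, ?_, fun x => ?_,
    fun x => ?_⟩
  · exact ρ.hasCompactSupport_normed.contDiff_convolution_left _ hρ
      (hφ.continuous.locallyIntegrable)
  · refine closure_minimal ((support_convolution_subset _).trans ?_) Metric.isClosed_cthickening
    rintro _ ⟨y, hy, z, hz, rfl⟩
    rw [ρ.support_normed_eq] at hy
    refine Metric.mem_cthickening_of_dist_le _ z _ _ (subset_tsupport _ hz) ?_
    have : ‖y‖ < r := by simpa using hy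
    simpa using this.le.trans (min_le_left _ _)
  · refine ρ.dist_normed_convolution_le hφ.continuous.aestronglyMeasurable fun y hy => (h₁ ?_).le
    exact (Metric.mem_ball.1 hy).trans_le ((min_le_right _ _).trans (min_le_left _ _))
  · rw [(hd x).fderiv, ← dist_eq_norm]
    refine ρ.dist_normed_convolution_le hφ'.aestronglyMeasurable fun y hy => (h₂ ?_).le
    exact (Metric.mem_ball.1 hy).trans_le ((min_le_right _ _).trans (min_le_right _ _))

theorem norm_sq_eq_sum_apply_single {n : ℕ} (L : EuclideanSpace ℝ (Fin n) →L[ℝ] ℝ) :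
    ‖L‖ ^ 2 = ∑ i, L (EuclideanSpace.single i 1) ^ 2 := by
  obtain ⟨v, rfl⟩ := (InnerProductSpace.toDual ℝ (EuclideanSpace ℝ (Fin n))).surjective L
  rw [LinearIsometryEquiv.norm_map, EuclideanSpace.norm_sq_eq]
  simp [EuclideanSpace.inner_single_right]

theorem continuous_fderiv_apply_of_contDiff {E : Type*} [NormedAddCommGroup E] [NormedSpace ℝ E]
    {u : E → ℝ} (hu : ContDiff ℝ 1 u) (v : E) : Continuous fun x => fderiv ℝ u x v :=
  (hu.continuous_fderiv one_ne_zero).clm_apply continuous_const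

theorem tsupport_lap_subset {n : ℕ} (φ : EuclideanSpace ℝ (Fin n) → ℝ) :
    tsupport (lap φ) ⊆ tsupport φ := by
  refine closure_minimal (fun x hx => ?_) (isClosed_tsupport φ)
  obtain ⟨i, -, hi⟩ := Finset.exists_ne_zero_of_sum_ne_zero hx
  exact tsupport_fderiv_apply_subset ℝ (EuclideanSpace.single i 1)
    (tsupport_fderiv_apply_subset ℝ (EuclideanSpace.single i 1) (subset_tsupport _ hi))

theorem integral_mul_lap {n : ℕ} {u φ : EuclideanSpace ℝ (Fin n) → ℝ} (hu : ContDiff ℝ 1 u)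
    (hφ : ContDiff ℝ 2 φ) (hc : HasCompactSupport φ) :
    ∫ x, u x * lap φ x = -∫ x, ∑ i, fderiv ℝ u x (EuclideanSpace.single i 1) *
      fderiv ℝ φ x (EuclideanSpace.single i 1) := by
  have hφ' (v : EuclideanSpace ℝ (Fin n)) : ContDiff ℝ 1 fun x => fderiv ℝ φ x v :=
    (hφ.fderiv_right (by norm_num)).clm_apply contDiff_const
  have hc' (v : EuclideanSpace ℝ (Fin n)) : HasCompactSupport fun x => fderiv ℝ φ x v :=
    hc.fderiv_apply ℝ v
  have h₁ (i : Fin n) : Integrable fun x => fderiv ℝ u x (EuclideanSpace.single i 1) *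
      fderiv ℝ φ x (EuclideanSpace.single i 1) :=
    ((continuous_fderiv_apply_of_contDiff hu _).mul
      (hφ' _).continuous).integrable_of_hasCompactSupport (hc' _).mul_left
  have h₂ (i : Fin n) : Integrable fun x => u x * fderiv ℝ (fun y => fderiv ℝ φ y
      (EuclideanSpace.single i 1)) x (EuclideanSpace.single i 1) :=
    (hu.continuous.mul (continuous_fderiv_apply_of_contDiff (hφ' _)
      _)).integrable_of_hasCompactSupport ((hc' _).fderiv_apply ℝ _).mul_left
  simp only [lap, Finset.mul_sum]
  rw [integral_finsetSum _ fun i _ => h₂ i, integral_finsetSum _ fun i _ => h₁ i,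
    ← Finset.sum_neg_distrib]
  refine Finset.sum_congr rfl fun i _ => ?_
  exact integral_mul_fderiv_eq_neg_fderiv_mul_of_integrable (h₁ i) (h₂ i)
    ((hu.continuous.mul (hφ' _).continuous).integrable_of_hasCompactSupport (hc' _).mul_left)
    (fun x _ => hu.differentiable one_ne_zero x) fun x _ => (hφ' _).differentiable one_ne_zero x

/-- The weak equation `Δu + ∇W · ∇u = 0` extends from smooth to `C¹` test functions. -/
theorem integral_eq_zero_of_contDiff_one {n : ℕ} {Ω : Set (EuclideanSpace ℝ (Fin n))}
    (hΩ : IsOpen Ω) {u W : EuclideanSpace ℝ (Fin n) → ℝ} (hu : ContDiff ℝ 1 u)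
    (hW : ContDiff ℝ 1 W)
    (h : ∀ φ : EuclideanSpace ℝ (Fin n) → ℝ,
      ContDiff ℝ (⊤ : ℕ∞) φ → HasCompactSupport φ → tsupport φ ⊆ Ω →
      ∫ x, ∑ i, fderiv ℝ u x (EuclideanSpace.single i 1) *
        (fderiv ℝ W x (EuclideanSpace.single i 1) * φ x -
          fderiv ℝ φ x (EuclideanSpace.single i 1)) = 0)
    {φ : EuclideanSpace ℝ (Fin n) → ℝ} (hφ : ContDiff ℝ 1 φ) (hc : HasCompactSupport φ)
    (hφΩ : tsupport φ ⊆ Ω) :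
    ∫ x, ∑ i, fderiv ℝ u x (EuclideanSpace.single i 1) *
      (fderiv ℝ W x (EuclideanSpace.single i 1) * φ x -
        fderiv ℝ φ x (EuclideanSpace.single i 1)) = 0 := by
  obtain ⟨δ, hδ, hδΩ⟩ := hc.isCompact.exists_cthickening_subset_open hΩ hφΩ
  set K := Metric.cthickening δ (tsupport φ)
  have hKc : IsCompact K := hc.isCompact.cthickening
  choose ψ hψ hψK hψφ hψφ' using fun k : ℕ =>
    exists_contDiff_forall_norm_fderiv_sub_le hφ hc hδ (Nat.one_div_pos_of_nat (α := ℝ) (n := k))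
  have hψc (k : ℕ) : HasCompactSupport (ψ k) :=
    hKc.of_isClosed_subset (isClosed_tsupport _) (hψK k)
  have hcu (v : EuclideanSpace ℝ (Fin n)) := continuous_fderiv_apply_of_contDiff hu v
  have hcW (v : EuclideanSpace ℝ (Fin n)) := continuous_fderiv_apply_of_contDiff hW v
  have hcφ (v : EuclideanSpace ℝ (Fin n)) := continuous_fderiv_apply_of_contDiff hφ v
  have hle (k : ℕ) : 1 / ((k : ℝ) + 1) ≤ 1 := by
    rw [div_le_one (by positivity)]
    linarith [k.cast_nonneg (α := ℝ)]
  have hnorm (k : ℕ) (x : EuclideanSpace ℝ (Fin n)) (i : Fin n) :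
      |fderiv ℝ (ψ k) x (EuclideanSpace.single i 1) - fderiv ℝ φ x (EuclideanSpace.single i 1)| ≤
        1 / ((k : ℝ) + 1) := by
    refine le_trans ?_ (hψφ' k x)
    simpa using (fderiv ℝ (ψ k) x - fderiv ℝ φ x).le_opNorm (EuclideanSpace.single i 1)
  refine tendsto_nhds_unique (f := fun k : ℕ => ∫ x, ∑ i,
    fderiv ℝ u x (EuclideanSpace.single i 1) *
      (fderiv ℝ W x (EuclideanSpace.single i 1) * ψ k x -
        fderiv ℝ (ψ k) x (EuclideanSpace.single i 1))) (l := Filter.atTop) ?_ ?_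
  · refine tendsto_integral_of_dominated_convergence (K.indicator fun x => ∑ i,
      |fderiv ℝ u x (EuclideanSpace.single i 1)| *
        (|fderiv ℝ W x (EuclideanSpace.single i 1)| * (|φ x| + 1) +
          (|fderiv ℝ φ x (EuclideanSpace.single i 1)| + 1))) (fun k => ?_) ?_ (fun k => ?_) ?_
    · have hcψ (v : EuclideanSpace ℝ (Fin n)) :=
        continuous_fderiv_apply_of_contDiff ((hψ k).of_le (by simp)) v
      have := (hψ k).continuous
      exact Continuous.aestronglyMeasurable (by fun_prop)
    · rw [integrable_indicator_iff hKc.isClosed.measurableSet]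
      have := hφ.continuous
      exact ContinuousOn.integrableOn_compact hKc (Continuous.continuousOn (by fun_prop))
    · refine Filter.Eventually.of_forall fun x => ?_
      by_cases hx : x ∈ K
      · rw [Set.indicator_of_mem hx]
        refine (norm_sum_le _ _).trans (Finset.sum_le_sum fun i _ => ?_)
        have h₁ := (abs_sub_abs_le_abs_sub _ _).trans ((hψφ k x).trans (hle k))
        have h₂ := (abs_sub_abs_le_abs_sub _ _).trans ((hnorm k x i).trans (hle k))
        rw [norm_mul, Real.norm_eq_abs]
        gcongr
        refine (norm_sub_le _ _).trans ?_
        rw [norm_mul, Real.norm_eq_abs, Real.norm_eq_abs, Real.norm_eq_abs]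
        gcongr <;> linarith
      · rw [Set.indicator_of_notMem hx]
        have h₁ : ψ k x = 0 := image_eq_zero_of_notMem_tsupport fun h => hx (hψK k h)
        have h₂ : fderiv ℝ (ψ k) x = 0 := fderiv_of_notMem_tsupport ℝ fun h => hx (hψK k h)
        simp [h₁, h₂]
    · refine Filter.Eventually.of_forall fun x => tendsto_finsetSum _ fun i _ => ?_
      refine ((Filter.Tendsto.const_mul _ ?_).sub ?_).const_mul _
      · exact tendsto_iff_norm_sub_tendsto_zero.2 (squeeze_zero (fun _ => norm_nonneg _)
          (fun k => hψφ k x) tendsto_one_div_add_atTop_nhds_zero_nat)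
      · exact tendsto_iff_norm_sub_tendsto_zero.2 (squeeze_zero (fun _ => norm_nonneg _)
          (fun k => hnorm k x i) tendsto_one_div_add_atTop_nhds_zero_nat)
  · simp only [fun k => h (ψ k) (hψ k) (hψc k) ((hψK k).trans hδΩ)]
    exact tendsto_const_nhds

/-- Weak maximum principle for `Δu + ∇W · ∇u = 0`, which has the divergence form
`div (exp W ∇u) = 0`. -/
theorem nonpos_of_weak_solution {n : ℕ} (hn : 1 ≤ n) {Ω : Set (EuclideanSpace ℝ (Fin n))}
    (hΩ : IsOpen Ω) (hΩb : Bornology.IsBounded Ω)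
    {u W : EuclideanSpace ℝ (Fin n) → ℝ} (hu : ContDiff ℝ 1 u)
    (hW : ContDiff ℝ 1 W) (hu0 : ∀ x ∉ Ω, u x = 0)
    (h : ∀ φ : EuclideanSpace ℝ (Fin n) → ℝ,
      ContDiff ℝ (⊤ : ℕ∞) φ → HasCompactSupport φ → tsupport φ ⊆ Ω →
      ∫ x, ∑ i, fderiv ℝ u x (EuclideanSpace.single i 1) *
        (fderiv ℝ W x (EuclideanSpace.single i 1) * φ x -
          fderiv ℝ φ x (EuclideanSpace.single i 1)) = 0)
    (x : EuclideanSpace ℝ (Fin n)) : u x ≤ 0 := by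
  refine le_of_forall_pos_le_add fun ε hε => ?_
  rw [zero_add]
  have hg : ContDiff ℝ 1 fun t => expNegInvGlue (t - ε) :=
    expNegInvGlue.contDiff.comp (contDiff_id.sub contDiff_const)
  have hgmono : Monotone fun t => expNegInvGlue (t - ε) :=
    fun s t hst => expNegInvGlue.monotone (by simpa using hst)
  set g : ℝ → ℝ := fun t => expNegInvGlue (t - ε) with hgdef
  have hg0 {t : ℝ} : g t = 0 ↔ t ≤ ε := by simp [hgdef]
  have hdu (x) := (hu.differentiable one_ne_zero x).hasFDerivAt
  have hdW (x) := (hW.differentiable one_ne_zero x).hasFDerivAt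
  have hdgu (x) : HasFDerivAt (g ∘ u) (deriv g (u x) • fderiv ℝ u x) x :=
    (hg.differentiable one_ne_zero (u x)).hasDerivAt.comp_hasFDerivAt x (hdu x)
  have hsub : {x | ε ≤ u x} ⊆ Ω := fun x hx => by
    by_contra hxΩ
    have : ε ≤ u x := hx
    linarith [hu0 x hxΩ]
  have hclosed : IsClosed {x | ε ≤ u x} := isClosed_le continuous_const hu.continuous
  have hφ : ContDiff ℝ 1 fun x => Real.exp (W x) * g (u x) := hW.exp.mul (hg.comp hu)
  have hsupp : tsupport (fun x => Real.exp (W x) * g (u x)) ⊆ {x | ε ≤ u x} := by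
    refine closure_minimal (fun x hx => ?_) hclosed
    by_contra hlt
    exact hx (by simp [hg0.2 (not_le.1 hlt).le])
  have hc : HasCompactSupport fun x => Real.exp (W x) * g (u x) :=
    (Metric.isCompact_of_isClosed_isBounded hclosed (hΩb.subset hsub)).of_isClosed_subset
      (isClosed_tsupport _) hsupp
  have key := integral_eq_zero_of_contDiff_one hΩ hu hW h hφ hc (hsupp.trans hsub)
  have hpt (x) : ∑ i, fderiv ℝ u x (EuclideanSpace.single i 1) *
      (fderiv ℝ W x (EuclideanSpace.single i 1) * (Real.exp (W x) * g (u x)) -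
        fderiv ℝ (fun x => Real.exp (W x) * g (u x)) x (EuclideanSpace.single i 1)) =
      -(Real.exp (W x) * (deriv g (u x) * ‖fderiv ℝ u x‖ ^ 2)) := by
    have hd : fderiv ℝ (fun x => Real.exp (W x) * g (u x)) x = _ :=
      ((hdW x).exp.mul (hdgu x)).fderiv
    simp only [hd, norm_sq_eq_sum_apply_single, Finset.mul_sum, ← Finset.sum_neg_distrib]
    refine Finset.sum_congr rfl fun i _ => ?_
    simp
    ring
  simp only [hpt, integral_neg, neg_eq_zero] at key
  have hnonneg (x) : 0 ≤ Real.exp (W x) * (deriv g (u x) * ‖fderiv ℝ u x‖ ^ 2) := by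
    have := hgmono.deriv_nonneg (x := u x)
    positivity
  have hcont : Continuous fun x => Real.exp (W x) * (deriv g (u x) * ‖fderiv ℝ u x‖ ^ 2) := by
    have h₁ := hu.continuous_fderiv one_ne_zero
    have h₂ := hg.continuous_deriv le_rfl
    have h₃ := hu.continuous
    have h₄ := hW.continuous
    fun_prop
  have hcs : HasCompactSupport
      fun x => Real.exp (W x) * (deriv g (u x) * ‖fderiv ℝ u x‖ ^ 2) := by
    refine HasCompactSupport.intro (hΩb.isCompact_closure) fun x hx => ?_
    have : x ∉ tsupport u := fun hxs => hx (closure_mono (fun y hy => by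
      by_contra hyΩ
      exact hy (hu0 y hyΩ)) hxs)
    simp [fderiv_of_notMem_tsupport ℝ this]
  have hzero := ((integral_eq_zero_iff_of_nonneg hnonneg
    (hcont.integrable_of_hasCompactSupport hcs)).1 key)
  replace hzero := (Continuous.ae_eq_iff_eq volume hcont continuous_const).1 hzero
  have hfd (x) : fderiv ℝ (g ∘ u) x = 0 := by
    rw [(hdgu x).fderiv]
    have : Real.exp (W x) * (deriv g (u x) * ‖fderiv ℝ u x‖ ^ 2) = 0 := congrFun hzero x
    simpa [Real.exp_ne_zero] using this
  have : Nonempty (Fin n) := ⟨⟨0, hn⟩⟩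
  obtain ⟨y, hy⟩ : ∃ y, y ∉ Ω := by
    by_contra! hall
    exact NormedSpace.unbounded_univ ℝ (EuclideanSpace ℝ (Fin n))
      (hΩb.subset fun y _ => hall y)
  have hconst := is_const_of_fderiv_eq_zero (fun z => (hdgu z).differentiableAt) hfd x y
  rw [Function.comp_apply, Function.comp_apply, hu0 y hy] at hconst
  exact hg0.1 (hconst.trans (hg0.2 hε.le))

/-- Final uniqueness step of Theorem 1.1: if `w₁, w₂` are `C¹`, agree
outside the bounded open set `Ω`, and satisfy
`(1/2)Δ(w₁-w₂) + (1/4)(‖∇w₁‖² - ‖∇w₂‖²) = 0` in `Ω` in the sense of distributions,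
then `w₁ = w₂` everywhere. -/
theorem stmt_19 (n : ℕ) (hn : 1 ≤ n)
    (Ω : Set (EuclideanSpace ℝ (Fin n))) (hΩo : IsOpen Ω) (hΩb : Bornology.IsBounded Ω)
    (w₁ w₂ : EuclideanSpace ℝ (Fin n) → ℝ)
    (hw₁ : ContDiff ℝ 1 w₁) (hw₂ : ContDiff ℝ 1 w₂)
    (heq : ∀ x ∉ Ω, w₁ x = w₂ x)
    (hweak : ∀ φ : EuclideanSpace ℝ (Fin n) → ℝ,
      ContDiff ℝ (⊤ : ℕ∞) φ → HasCompactSupport φ → tsupport φ ⊆ Ω →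
      ∫ x in Ω, ((1 / 2) * (w₁ x - w₂ x) * lap φ x +
        (1 / 4) * (‖fderiv ℝ w₁ x‖ ^ 2 - ‖fderiv ℝ w₂ x‖ ^ 2) * φ x) = 0) :
    w₁ = w₂ := by
  have hu : ContDiff ℝ 1 (w₁ - w₂) := hw₁.sub hw₂
  have hW : ContDiff ℝ 1 ((1 / 2 : ℝ) • (w₁ + w₂)) := contDiff_const.smul (hw₁.add hw₂)
  have hu0 : ∀ x ∉ Ω, (w₁ - w₂) x = 0 := fun x hx => sub_eq_zero.2 (heq x hx)
  have hd₁ (x) := hw₁.differentiable one_ne_zero x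
  have hd₂ (x) := hw₂.differentiable one_ne_zero x
  have hfu (x) : fderiv ℝ (w₁ - w₂) x = fderiv ℝ w₁ x - fderiv ℝ w₂ x :=
    fderiv_sub (hd₁ x) (hd₂ x)
  have hfW (x) : fderiv ℝ ((1 / 2 : ℝ) • (w₁ + w₂)) x =
      (1 / 2 : ℝ) • (fderiv ℝ w₁ x + fderiv ℝ w₂ x) := by
    rw [fderiv_const_smul ((hd₁ x).add (hd₂ x)), fderiv_add (hd₁ x) (hd₂ x)]
  have hsol : ∀ φ : EuclideanSpace ℝ (Fin n) → ℝ,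
      ContDiff ℝ (⊤ : ℕ∞) φ → HasCompactSupport φ → tsupport φ ⊆ Ω →
      ∫ x, ∑ i, fderiv ℝ (w₁ - w₂) x (EuclideanSpace.single i 1) *
        (fderiv ℝ ((1 / 2 : ℝ) • (w₁ + w₂)) x (EuclideanSpace.single i 1) * φ x -
          fderiv ℝ φ x (EuclideanSpace.single i 1)) = 0 := by
    intro φ hφ hc hφΩ
    have hφ2 : ContDiff ℝ 2 φ := contDiff_infty.1 hφ 2
    have hcu (v : EuclideanSpace ℝ (Fin n)) := continuous_fderiv_apply_of_contDiff hu v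
    have hcW (v : EuclideanSpace ℝ (Fin n)) := continuous_fderiv_apply_of_contDiff hW v
    have hcφ (v : EuclideanSpace ℝ (Fin n)) :=
      continuous_fderiv_apply_of_contDiff (hφ2.of_le (by norm_num)) v
    have hlap : Continuous (lap φ) := continuous_finsetSum _ fun i _ =>
      continuous_fderiv_apply_of_contDiff
        ((hφ2.fderiv_right (by norm_num)).clm_apply contDiff_const) _
    have hlapc : HasCompactSupport (lap φ) :=
      hc.isCompact.of_isClosed_subset (isClosed_tsupport _) (tsupport_lap_subset φ)
    have hweakφ := hweak φ hφ hc hφΩ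
    rw [setIntegral_eq_integral_of_forall_compl_eq_zero fun x hx => by
      have h₁ : φ x = 0 := image_eq_zero_of_notMem_tsupport fun h => hx (hφΩ h)
      have h₂ : lap φ x = 0 :=
        image_eq_zero_of_notMem_tsupport fun h => hx (hφΩ (tsupport_lap_subset φ h))
      simp [h₁, h₂]] at hweakφ
    have hdrift (x) : (1 / 2) * (w₁ x - w₂ x) * lap φ x +
        (1 / 4) * (‖fderiv ℝ w₁ x‖ ^ 2 - ‖fderiv ℝ w₂ x‖ ^ 2) * φ x =
        (1 / 2) * ((w₁ - w₂) x * lap φ x +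
          (∑ i, fderiv ℝ (w₁ - w₂) x (EuclideanSpace.single i 1) *
            fderiv ℝ ((1 / 2 : ℝ) • (w₁ + w₂)) x (EuclideanSpace.single i 1)) * φ x) := by
      have hs : ∑ i, fderiv ℝ (w₁ - w₂) x (EuclideanSpace.single i 1) *
            fderiv ℝ ((1 / 2 : ℝ) • (w₁ + w₂)) x (EuclideanSpace.single i 1) =
          (1 / 2) * (‖fderiv ℝ w₁ x‖ ^ 2 - ‖fderiv ℝ w₂ x‖ ^ 2) := by
        rw [norm_sq_eq_sum_apply_single, norm_sq_eq_sum_apply_single,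
          ← Finset.sum_sub_distrib, Finset.mul_sum]
        refine Finset.sum_congr rfl fun i _ => ?_
        rw [hfu, hfW]
        simp
        ring
      rw [hs, Pi.sub_apply]
      ring
    have hφcont := hφ.continuous
    have hi₁ : Integrable fun x => (w₁ - w₂) x * lap φ x :=
      (hu.continuous.mul hlap).integrable_of_hasCompactSupport hlapc.mul_left
    have hi₂ : Integrable fun x => (∑ i, fderiv ℝ (w₁ - w₂) x (EuclideanSpace.single i 1) *
        fderiv ℝ ((1 / 2 : ℝ) • (w₁ + w₂)) x (EuclideanSpace.single i 1)) * φ x :=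
      Continuous.integrable_of_hasCompactSupport (by fun_prop) hc.mul_left
    have hi₃ : Integrable fun x => ∑ i, fderiv ℝ (w₁ - w₂) x (EuclideanSpace.single i 1) *
        fderiv ℝ φ x (EuclideanSpace.single i 1) :=
      integrable_finsetSum _ fun i _ => Continuous.integrable_of_hasCompactSupport (by fun_prop)
        (hc.fderiv_apply ℝ _).mul_left
    simp only [hdrift] at hweakφ
    rw [integral_const_mul, integral_add hi₁ hi₂, integral_mul_lap hu hφ2 hc] at hweakφ
    simp only [mul_sub, ← mul_assoc, Finset.sum_sub_distrib, ← Finset.sum_mul]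
    rw [integral_sub hi₂ hi₃]
    linarith
  have hle := nonpos_of_weak_solution hn hΩo hΩb hu hW hu0 hsol
  have hfneg (x) : fderiv ℝ (-(w₁ - w₂)) x = -fderiv ℝ (w₁ - w₂) x := fderiv_neg
  have hge := nonpos_of_weak_solution (u := -(w₁ - w₂)) hn hΩo hΩb hu.neg hW
    (fun x hx => by rw [Pi.neg_apply, hu0 x hx, neg_zero]) fun φ hφ hc hφΩ => by
      simp only [hfneg, neg_apply, neg_mul, Finset.sum_neg_distrib,
        integral_neg, hsol φ hφ hc hφΩ, neg_zero]
  funext x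
  have h₁ := hle x
  have h₂ := hge x
  simp only [Pi.neg_apply, Pi.sub_apply] at h₁ h₂
  linarith
end
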